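/- arXiv:2503.05363 — 10 statements merged into one kernel-verified Lean document; each statement's English description precedes it below -/
import Mathlib

section
/- For every integer n ≥ 2 and every integer k ≥ 1, the probability that at least one passenger is lonely is strictly larger with k+1 buses than with k buses: p_{n,k+1,1} > p_{n,k,1}. -/
open Finset

/-- The number of lonely passengers: passenger `p` is lonely if no other
passenger chose the same bus. -/
def lonelyCount (n k : ℕ) (a : Fin n → Fin k) : ℕ :=
  (Finset.univ.filter fun p => ∀ q, q ≠ p → a q ≠ a p).card

/-- `pnk n k r` is the probability that at least `r` of the `n` passengers are
lonely when each of them independently chooses one of `k` buses uniformly at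
random. -/
noncomputable def pnk (n k r : ℕ) : ℝ :=
  ((Finset.univ.filter fun a : Fin n → Fin k => r ≤ lonelyCount n k a).card : ℝ) /
    ((k : ℝ) ^ n)

/-- Nobody is alone in their fibre of `f`. -/
def NoLonely {α B : Type*} (f : α → B) : Prop := ∀ p, ∃ q, q ≠ p ∧ f q = f p

/-- A passenger in state `(some b, c)` sits in bus `b`; one in state `(none, c)` sits in an
extra bus and moves to bus `c` when that extra bus is removed. -/
def finalBus {B : Type*} (x : Option B × B) : B := x.1.getD x.2

/-- Before the extra bus is removed, `p` is the only passenger of the ordinary bus `b`. -/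
def Solo {α B : Type*} (ω : α → Option B × B) (p : α) (b : B) : Prop :=
  (ω p).1 = some b ∧ ∀ q, (ω q).1 = some b → q = p

section Decode

variable {α B : Type*} {ω : α → Option B × B} {p q : α} {b : B}

open Classical in
/-- A map which sends the configurations having a lonely passenger only before the removal of the
extra bus onto a set containing those having a lonely passenger only after the removal. -/
noncomputable def decode (ω : α → Option B × B) (q : α) : Option B × B :=
  match (ω q).1 with
  | none => if h : ∃ p, Solo ω p (ω q).2 then (none, (ω h.choose).2) else ω q
  | some b =>
    if Solo ω q b then (none, b)
    else if (∀ p c, ¬ Solo ω p c) ∧ ∃ p, ω p = (none, b) then (none, (ω q).2) else ω q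

theorem Solo.eq (hp : Solo ω p b) (hq : Solo ω q b) : p = q := hq.2 p hp.1

theorem decode_of_solo (h : Solo ω q b) : decode ω q = (none, b) := by
  have h1 := h.1
  simp [decode, h1, h]

theorem decode_of_mate (hq : ω q = (none, b)) (hp : Solo ω p b) :
    decode ω q = (none, (ω p).2) := by
  have h : ∃ p, Solo ω p b := ⟨p, hp⟩
  have h2 : h.choose = p := h.choose_spec.eq hp
  simp [decode, hq, h, h2]

theorem decode_of_none (hq : ω q = (none, b)) (h : ∀ p, ¬ Solo ω p b) : decode ω q = ω q := by
  simp [decode, hq, h]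

theorem decode_of_merged (h : ∀ p c, ¬ Solo ω p c) (hp : ω p = (none, b))
    (hq : (ω q).1 = some b) : decode ω q = (none, (ω q).2) := by
  have h2 : ∃ p, ω p = (none, b) := ⟨p, hp⟩
  simp [decode, hq, h, h2]

theorem decode_of_not_solo (hq : (ω q).1 = some b) (h : ¬ Solo ω q b)
    (h' : (∃ p c, Solo ω p c) ∨ ∀ p, ω p ≠ (none, b)) : decode ω q = ω q := by
  have h2 : ¬ ((∀ p c, ¬ Solo ω p c) ∧ ∃ p, ω p = (none, b)) := by
    rintro ⟨h3, p, hp⟩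
    rcases h' with ⟨p, c, h4⟩ | h4
    · exact h3 p c h4
    · exact h4 p hp
  simp only [decode, hq, if_neg h, if_neg h2]

/-- Exchanging destinations along a partial matching of the extra bus's destinations, where all
destinations that end up with a single passenger are matched. -/
theorem exists_decode_eq_of_matching [DecidableEq B] (hω : NoLonely fun p => (ω p).1)
    {H T : Finset B} {g h : B → B} (hne : H.Nonempty) (hHT : Disjoint H T)
    (hH : ∀ b ∈ H, ∃ p, ω p = (none, b) ∧ ∀ q, finalBus (ω q) = b → q = p)
    (hT : ∀ b ∈ T, ∃ p, ω p = (none, b))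
    (hL : ∀ b p, ω p = (none, b) → (∀ q, finalBus (ω q) = b → q = p) → b ∈ H ∪ T)
    (hh : ∀ b ∈ H, h b ∈ T ∧ g (h b) = b) (hg : ∀ b ∈ T, g b ∈ H ∧ h (g b) = b) :
    ∃ ω' : α → Option B × B, ¬ (NoLonely fun p => (ω' p).1) ∧
      (NoLonely fun p => finalBus (ω' p)) ∧ decode ω' = ω := by
  have hempty : ∀ b ∈ H, ∀ q, (ω q).1 ≠ some b := by
    intro b hb q hq
    obtain ⟨p, hp, hu⟩ := hH b hb
    have := hu q (by simp [finalBus, hq])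
    subst this
    simp [hp] at hq
  have huniq : ∀ b ∈ H, ∀ p q, ω p = (none, b) → ω q = (none, b) → p = q := by
    intro b hb p q hp hq
    obtain ⟨r, hr, hu⟩ := hH b hb
    rw [hu p (by simp [finalBus, hp]), hu q (by simp [finalBus, hq])]
  have hTH : ∀ b ∈ T, b ∉ H := fun b hb hb' => Finset.disjoint_left.1 hHT hb' hb
  let f : Option B × B → Option B × B := fun x =>
    match x.1 with
    | some _ => x
    | none => if x.2 ∈ H then (some x.2, h x.2) else if x.2 ∈ T then (none, g x.2) else x
  have f1 : ∀ b c, f (some b, c) = (some b, c) := fun b c => rfl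
  have f2 : ∀ b ∈ H, f (none, b) = (some b, h b) := fun b hb => by simp [f, hb]
  have f3 : ∀ b ∈ T, f (none, b) = (none, g b) := fun b hb => by simp [f, hb, hTH b hb]
  have f4 : ∀ b, b ∉ H → b ∉ T → f (none, b) = (none, b) := fun b hb hb' => by simp [f, hb, hb']
  have hin : ∀ q b, (f (ω q)).1 = some b ↔ (ω q).1 = some b ∨ (b ∈ H ∧ ω q = (none, b)) := by
    intro q b
    rcases hq : ω q with ⟨_ | c, d⟩
    · by_cases hd : d ∈ H
      · rw [f2 d hd]; grind
      · by_cases hd' : d ∈ T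
        · rw [f3 d hd']; grind
        · rw [f4 d hd hd']; grind
    · rw [f1]; simp
  have hsolo : ∀ p b, Solo (fun q => f (ω q)) p b ↔ b ∈ H ∧ ω p = (none, b) := by
    intro p b
    constructor
    · rintro ⟨h1, h2⟩
      rcases (hin p b).1 h1 with h3 | h3
      · obtain ⟨q, hq, hqp⟩ := hω p
        exact absurd (h2 q ((hin q b).2 (Or.inl (hqp.trans h3)))) hq
      · exact h3
    · rintro ⟨hb, hp⟩
      refine ⟨(hin p b).2 (Or.inr ⟨hb, hp⟩), fun q hq => ?_⟩
      rcases (hin q b).1 hq with h3 | h3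
      · exact absurd h3 (hempty b hb q)
      · exact huniq b hb q p h3.2 hp
  obtain ⟨b₀, hb₀⟩ := hne
  obtain ⟨p₀, hp₀, -⟩ := hH b₀ hb₀
  have hsolo₀ := (hsolo p₀ b₀).2 ⟨hb₀, hp₀⟩
  refine ⟨fun q => f (ω q), ?_, ?_, ?_⟩
  · intro hN
    obtain ⟨q, hq, hqp⟩ := hN p₀
    exact hq (hsolo₀.2 q (hqp.trans hsolo₀.1))
  · intro p
    have key : ∀ q b c, ω q = (some b, c) → finalBus (f (ω q)) = b := by
      intro q b c hq
      rw [hq, f1]; rfl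
    rcases hp : ω p with ⟨_ | b, d⟩
    · by_cases hd : d ∈ H
      · obtain ⟨hdT, -⟩ := hh d hd
        obtain ⟨q, hq⟩ := hT _ hdT
        refine ⟨q, ?_, ?_⟩
        · rintro rfl
          rw [hp] at hq
          have : d = h d := congrArg Prod.snd hq
          exact hTH _ hdT (this ▸ hd)
        · simp only [hq, hp, f2 d hd, f3 _ hdT, (hh d hd).2]; rfl
      · by_cases hd' : d ∈ T
        · obtain ⟨hgH, -⟩ := hg d hd'
          obtain ⟨q, hq, -⟩ := hH _ hgH
          refine ⟨q, ?_, ?_⟩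
          · rintro rfl
            rw [hp] at hq
            have : d = g d := congrArg Prod.snd hq
            exact hd (this ▸ hgH)
          · simp only [hq, hp, f3 d hd', f2 _ hgH]; rfl
        · have hd2 : ∃ q, finalBus (ω q) = d ∧ q ≠ p := by
            by_contra! hcon
            have := hL d p hp hcon
            simp [hd, hd'] at this
          obtain ⟨q, hq, hqp⟩ := hd2
          refine ⟨q, hqp, ?_⟩
          simp only [hp, f4 d hd hd']
          rcases hq' : ω q with ⟨_ | c, e⟩
          · rw [hq'] at hq
            have : e = d := hq
            subst this
            rw [f4 e hd hd']
          · rw [hq'] at hq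
            have : c = d := hq
            subst this
            rw [f1]; rfl
    · obtain ⟨q, hq, hqp⟩ := hω p
      refine ⟨q, hq, ?_⟩
      have hqb : ω q = (some b, (ω q).2) := by
        ext1
        · simpa [hp] using hqp
        · rfl
      exact (key q b _ hqb).trans (key p b d hp).symm
  · funext q
    rcases hq : ω q with ⟨_ | b, d⟩
    · by_cases hd : d ∈ H
      · exact decode_of_solo ((hsolo q d).2 ⟨hd, hq⟩)
      · by_cases hd' : d ∈ T
        · obtain ⟨hgH, hgd⟩ := hg d hd'
          obtain ⟨p, hp, -⟩ := hH _ hgH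
          rw [decode_of_mate (b := g d) (p := p) (by simp only [hq, f3 d hd'])
            ((hsolo _ _).2 ⟨hgH, hp⟩)]
          simp only [hp, f2 _ hgH, hgd]
        · have hfq : (fun q => f (ω q)) q = (none, d) := by simp only [hq, f4 d hd hd']
          rw [decode_of_none (ω := fun q => f (ω q)) hfq (fun p' hp' => hd ((hsolo p' d).1 hp').1)]
          exact hfq
    · have hfq : (fun q => f (ω q)) q = (some b, d) := by simp only [hq, f1]
      refine (decode_of_not_solo (ω := fun q => f (ω q)) (congrArg Prod.fst hfq) (fun hs => ?_)
        (Or.inl ⟨p₀, b₀, hsolo₀⟩)).trans hfq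
      have := ((hsolo q b).1 hs).2
      rw [hq] at this
      simp at this

/-- Putting everybody from the extra bus except `p` into the destination of `p`, when all
passengers of the extra bus would become lonely. -/
theorem exists_decode_eq_of_forall_lonely (hω : NoLonely fun p => (ω p).1)
    (hS : ∀ p c, ω p = (none, c) → ∀ q, finalBus (ω q) = c → q = p) {p₁ p₂ : α}
    (hp : ω p = (none, b)) (h₁ : (ω p₁).1 = none) (h₂ : (ω p₂).1 = none)
    (h₁p : p₁ ≠ p) (h₂p : p₂ ≠ p) (h₁₂ : p₁ ≠ p₂) :
    ∃ ω' : α → Option B × B, ¬ (NoLonely fun p => (ω' p).1) ∧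
      (NoLonely fun p => finalBus (ω' p)) ∧ decode ω' = ω := by
  classical
  let ω' : α → Option B × B := fun q =>
    if (ω q).1 = none ∧ q ≠ p then (some b, (ω q).2) else ω q
  have e1 : ∀ q, (ω q).1 = none → q ≠ p → ω' q = (some b, (ω q).2) := fun q h h' => by
    simp [ω', h, h']
  have e2 : ∀ q, (ω q).1 ≠ none → ω' q = ω q := fun q h => by simp [ω', h]
  have e3 : ω' p = (none, b) := by simp [ω', hp]
  have hempty : ∀ q, (ω q).1 ≠ some b := by
    intro q hq
    have := hS p b hp q (by simp [finalBus, hq])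
    subst this
    simp [hp] at hq
  have hnone : ∀ q, (ω' q).1 = none → q = p := by
    intro q hq
    by_contra hqp
    by_cases hq' : (ω q).1 = none
    · simp [e1 q hq' hqp] at hq
    · exact hq' (by rwa [e2 q hq'] at hq)
  have hsolo : ∀ q c, ¬ Solo ω' q c := by
    rintro q c ⟨hq, hu⟩
    by_cases hq' : (ω q).1 = none
    · have hqp : q ≠ p := by
        rintro rfl
        simp [e3] at hq
      rw [e1 q hq' hqp] at hq
      exact h₁₂ ((hu p₁ (by rw [e1 p₁ h₁ h₁p]; exact hq)).trans
        (hu p₂ (by rw [e1 p₂ h₂ h₂p]; exact hq)).symm)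
    · obtain ⟨r, hr, hrq⟩ := hω q
      rw [e2 q hq'] at hq
      have hr' : (ω r).1 = some c := hrq.trans hq
      exact hr (hu r (by rw [e2 r (by simp [hr'])]; exact hr'))
  refine ⟨ω', ?_, ?_, ?_⟩
  · intro hN
    obtain ⟨q, hq, hqp⟩ := hN p
    exact hq (hnone q (by simpa [e3] using hqp))
  · intro q
    by_cases hq' : (ω q).1 = none
    · by_cases hqp : q = p
      · subst hqp
        exact ⟨p₁, h₁p, by simp [e1 p₁ h₁ h₁p, e3, finalBus]⟩
      · exact ⟨p, Ne.symm hqp, by simp [e1 q hq' hqp, e3, finalBus]⟩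
    · obtain ⟨r, hr, hrq⟩ := hω q
      have hrq' : (ω r).1 = (ω q).1 := hrq
      refine ⟨r, hr, ?_⟩
      obtain ⟨c, hc⟩ := Option.ne_none_iff_exists'.1 hq'
      simp only [e2 q hq', e2 r (hrq' ▸ hq'), finalBus, hrq', hc, Option.getD_some]
  · funext q
    by_cases hq' : (ω q).1 = none
    · by_cases hqp : q = p
      · subst hqp
        rw [decode_of_none e3 fun p => hsolo p b, e3, hp]
      · rw [decode_of_merged hsolo e3 (by rw [e1 q hq' hqp]), e1 q hq' hqp]
        exact Prod.ext hq'.symm rfl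
    · obtain ⟨c, hc⟩ := Option.ne_none_iff_exists'.1 hq'
      rw [decode_of_not_solo (b := c) (by rw [e2 q hq', hc]) (hsolo q c), e2 q hq']
      right
      intro r hr
      have := hnone r (by rw [hr])
      subst this
      rw [e3] at hr
      exact hempty q (hc.trans (congrArg (fun x => some x.2) hr).symm)

/-- Half of `L`, rounded up, can be matched with the other half, using an extra element `a` if
the cardinality is odd. -/
theorem exists_matching [DecidableEq B] (L : Finset B) (a : Option B) (ha : ∀ x ∈ a, x ∉ L)
    (hodd : a = none → Even L.card) (hL : L.Nonempty) :
    ∃ (H T : Finset B) (g h : B → B), H.Nonempty ∧ Disjoint H T ∧ H ⊆ L ∧ L ⊆ H ∪ T ∧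
      (∀ x ∈ T, x ∈ L ∨ x ∈ a) ∧ (∀ b ∈ H, h b ∈ T ∧ g (h b) = b) ∧
      (∀ b ∈ T, g b ∈ H ∧ h (g b) = b) := by
  have of_card : ∀ H T : Finset B, H.card = T.card → H.Nonempty → ∃ g h : B → B,
      (∀ b ∈ H, h b ∈ T ∧ g (h b) = b) ∧ (∀ b ∈ T, g b ∈ H ∧ h (g b) = b) := by
    intro H T hc hne
    let e := Finset.equivOfCardEq hc
    refine ⟨fun b => if hb : b ∈ T then e.symm ⟨b, hb⟩ else b,
      fun b => if hb : b ∈ H then e ⟨b, hb⟩ else b, ?_, ?_⟩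
    · intro b hb
      simp [hb]
    · intro b hb
      simp [hb]
  have hpos := hL.card_pos
  obtain ⟨H, hHL, hHc⟩ := Finset.exists_subset_card_eq (show (L.card + 1) / 2 ≤ L.card by omega)
  have hne : H.Nonempty := Finset.card_pos.1 (by omega)
  have hc := Finset.card_sdiff_of_subset hHL
  by_cases hev : Even L.card
  · obtain ⟨g, h, h1, h2⟩ := of_card H (L \ H) (by rw [hc]; grind) hne
    exact ⟨H, L \ H, g, h, hne, Finset.disjoint_sdiff, hHL, by simp, by grind, h1, h2⟩
  · obtain ⟨x, rfl⟩ : ∃ x, a = some x := Option.ne_none_iff_exists'.1 fun h => hev (hodd h)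
    have hx : x ∉ L := ha x rfl
    obtain ⟨g, h, h1, h2⟩ := of_card H (insert x (L \ H))
      (by rw [Finset.card_insert_of_notMem (by grind), hc]; grind) hne
    exact ⟨H, insert x (L \ H), g, h, hne, by
      rw [Finset.disjoint_left]; grind, hHL, by grind, by grind, h1, h2⟩

theorem exists_decode_eq [Fintype B] (hω : NoLonely fun p => (ω p).1)
    (hω' : ¬ NoLonely fun p => finalBus (ω p)) :
    ∃ ω' : α → Option B × B, ¬ (NoLonely fun p => (ω' p).1) ∧
      (NoLonely fun p => finalBus (ω' p)) ∧ decode ω' = ω := by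
  classical
  let L : Finset B := {b | ∃ p, ω p = (none, b) ∧ ∀ q, finalBus (ω q) = b → q = p}
  have hL : ∀ b, b ∈ L ↔ ∃ p, ω p = (none, b) ∧ ∀ q, finalBus (ω q) = b → q = p := by simp [L]
  have hlonely : ∃ p, ∀ q, finalBus (ω q) = finalBus (ω p) → q = p := by
    unfold NoLonely at hω'
    push Not at hω'
    obtain ⟨p, hp⟩ := hω'
    exact ⟨p, fun q hq => by_contra fun hne => hp q hne hq⟩
  obtain ⟨p, hp⟩ := hlonely
  have hnone : ω p = (none, (ω p).2) := by
    rcases hx : ω p with ⟨_ | b, c⟩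
    · rfl
    · obtain ⟨q, hq, hqp⟩ := hω p
      have hqp' : (ω q).1 = (ω p).1 := hqp
      exact absurd (hp q (by simp [finalBus, hqp', hx])) hq
  have hpL : (ω p).2 ∈ L := (hL _).2 ⟨p, hnone, fun q hq => hp q (by rw [hq, hnone]; rfl)⟩
  by_cases hcase : ∃ a : Option B, (∀ x ∈ a, x ∉ L ∧ ∃ p, ω p = (none, x)) ∧
      (a = none → Even L.card)
  · obtain ⟨a, ha, hodd⟩ := hcase
    obtain ⟨H, T, g, h, hne, hHT, hHL, hLHT, hT, h1, h2⟩ :=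
      exists_matching L a (fun x hx => (ha x hx).1) hodd ⟨_, hpL⟩
    refine exists_decode_eq_of_matching hω hne hHT (fun b hb => (hL b).1 (hHL hb))
      (fun b hb => ?_) (fun b p hb hb' => hLHT ((hL b).2 ⟨p, hb, hb'⟩)) h1 h2
    rcases hT b hb with h3 | h3
    · obtain ⟨p, hp, -⟩ := (hL b).1 h3
      exact ⟨p, hp⟩
    · exact (ha b h3).2
  · push Not at hcase
    have hodd : ¬ Even L.card := fun he =>
      (hcase none fun _ h => nomatch h).2 he
    have hall : ∀ x p, ω p = (none, x) → x ∈ L := by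
      intro x p hx
      by_contra hxL
      have := hcase (some x) (by
        intro y hy
        obtain rfl : x = y := by simpa using hy
        exact ⟨hxL, p, hx⟩)
      simp at this
    have hS : ∀ p c, ω p = (none, c) → ∀ q, finalBus (ω q) = c → q = p := by
      intro p c hc q hq
      obtain ⟨r, -, hr⟩ := (hL c).1 (hall c p hc)
      rw [hr q hq, hr p (by rw [hc]; rfl)]
    obtain ⟨p₁, h₁p, h₁⟩ := hω p
    have h₁n : (ω p₁).1 = none := h₁.trans (congrArg Prod.fst hnone)
    have h₁' : ω p₁ = (none, (ω p₁).2) := Prod.ext h₁n rfl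
    have hne : (ω p).2 ≠ (ω p₁).2 := by
      intro h
      exact h₁p (hS p _ hnone p₁ (by rw [h₁', h]; rfl))
    have hthird : ∃ c ∈ L, c ≠ (ω p).2 ∧ c ≠ (ω p₁).2 := by
      by_contra! hcon
      have : L = {(ω p).2, (ω p₁).2} := by
        ext c
        have := hall _ _ h₁'
        grind
      rw [this, Finset.card_pair hne] at hodd
      exact hodd even_two
    obtain ⟨c, hc, hcp, hcp₁⟩ := hthird
    obtain ⟨p₂, h₂, -⟩ := (hL c).1 hc
    refine exists_decode_eq_of_forall_lonely hω hS hnone h₁n (p₂ := p₂) (by rw [h₂]) h₁p ?_ ?_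
    · rintro rfl
      simp [h₂] at hcp
    · rintro rfl
      simp [h₂] at hcp₁

end Decode

section Counting

variable {α B : Type*}

theorem finalBus_decode_eq (ω : α → Option B × B) {b : B}
    (h1 : ∀ q, (ω q).1 = none ∨ (ω q).1 = some b) (h2 : ∀ q, (ω q).2 = b) (q : α) :
    finalBus (decode ω q) = b := by
  have h3 : ∀ q, finalBus (ω q) = b := fun q => by
    rcases h1 q with h | h <;> simp [finalBus, h, h2]
  unfold decode
  rcases h1 q with h | h <;> simp only [h] <;> split_ifs <;> simp [finalBus, h2, h]

open Classical in
theorem card_noLonely_lt [Fintype α] [Fintype B] [Nonempty B] [Nontrivial α] :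
    Fintype.card {ω : α → Option B × B // NoLonely fun p => (ω p).1} <
      Fintype.card {ω : α → Option B × B // NoLonely fun p => finalBus (ω p)} := by
  rw [Fintype.card_subtype, Fintype.card_subtype, ← Finset.card_sdiff_lt_card_sdiff_iff]
  set G := (univ.filter fun ω : α → Option B × B => NoLonely fun p => finalBus (ω p)) \
    univ.filter fun ω : α → Option B × B => NoLonely fun p => (ω p).1 with hG
  obtain ⟨b⟩ := ‹Nonempty B›
  obtain ⟨p⟩ := (inferInstance : Nonempty α)
  let ω₀ : α → Option B × B := fun q => if q = p then (none, b) else (some b, b)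
  have hb : ∀ q, finalBus (ω₀ q) = b := fun q => by
    by_cases h : q = p <;> simp [ω₀, h, finalBus]
  have hconst : ∀ f : α → B, (∀ q, f q = b) → NoLonely f := fun f hf p => by
    obtain ⟨q, hq⟩ := exists_ne p
    exact ⟨q, hq, by rw [hf, hf]⟩
  have hω₀ : ω₀ ∈ G := by
    simp only [hG, mem_sdiff, mem_filter, mem_univ, true_and]
    refine ⟨hconst _ hb, fun h => ?_⟩
    obtain ⟨q, hq, hqp⟩ := h p
    simp [ω₀, hq] at hqp
  have hdec : NoLonely fun q => finalBus (decode ω₀ q) := hconst _ <| finalBus_decode_eq ω₀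
    (fun q => by by_cases h : q = p <;> simp [ω₀, h])
    (fun q => by by_cases h : q = p <;> simp [ω₀, h])
  calc _ ≤ ((G.erase ω₀).image decode).card := Finset.card_le_card ?_
    _ ≤ (G.erase ω₀).card := Finset.card_image_le
    _ < G.card := Finset.card_erase_lt_of_mem hω₀
  intro ω hω
  simp only [mem_sdiff, mem_filter, mem_univ, true_and] at hω
  obtain ⟨ω', h1, h2, rfl⟩ := exists_decode_eq hω.1 hω.2
  refine Finset.mem_image_of_mem _ (Finset.mem_erase.2 ⟨?_, by simp [hG, h1, h2]⟩)
  rintro rfl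
  exact hω.2 hdec

open Classical in
theorem card_noLonely_prod {C : Type*} [Fintype α] [Fintype B] [Fintype C] :
    Fintype.card {ω : α → B × C // NoLonely fun p => (ω p).1} =
      Fintype.card {f : α → B // NoLonely f} * Fintype.card C ^ Fintype.card α := by
  rw [← Fintype.card_fun, ← Fintype.card_prod]
  exact Fintype.card_congr
    (((Equiv.arrowProdEquivProdArrow α (fun _ => B) (fun _ => C)).subtypeEquiv
      (q := fun x => NoLonely x.1) fun _ => Iff.rfl).trans
      (Equiv.prodSubtypeFstEquivSubtypeProd (p := fun f : α → B => NoLonely f)))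

/-- A state, seen as its final bus together with the remaining information. -/
def stateEquiv (B : Type*) : Option B × B ≃ B × Option B where
  toFun x := match x with
    | (some b, c) => (b, some c)
    | (none, c) => (c, none)
  invFun x := match x with
    | (b, some c) => (some b, c)
    | (c, none) => (none, c)
  left_inv := by rintro ⟨_ | _, _⟩ <;> rfl
  right_inv := by rintro ⟨_, _ | _⟩ <;> rfl

theorem stateEquiv_fst (x : Option B × B) : (stateEquiv B x).1 = finalBus x := by
  rcases x with ⟨_ | _, _⟩ <;> rfl

open Classical in
theorem card_noLonely_finalBus [Fintype α] [Fintype B] :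
    Fintype.card {ω : α → Option B × B // NoLonely fun p => finalBus (ω p)} =
      Fintype.card {f : α → B // NoLonely f} * (Fintype.card B + 1) ^ Fintype.card α := by
  rw [← Fintype.card_option, ← card_noLonely_prod]
  refine Fintype.card_congr (((Equiv.refl α).arrowCongr (stateEquiv B)).subtypeEquiv fun ω => ?_)
  simp [Equiv.arrowCongr, stateEquiv_fst]

open Classical in
theorem card_noLonely_congr {C : Type*} [Fintype α] [Fintype B] [Fintype C] (e : B ≃ C) :
    Fintype.card {f : α → B // NoLonely f} = Fintype.card {f : α → C // NoLonely f} :=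
  Fintype.card_congr (((Equiv.refl α).arrowCongr e).subtypeEquiv fun f => by
    simp [Equiv.arrowCongr, NoLonely])

end Counting

open Classical in
theorem pnk_one (n k : ℕ) (hk : 1 ≤ k) :
    pnk n k 1 = 1 - (Fintype.card {f : Fin n → Fin k // NoLonely f} : ℝ) / (k : ℝ) ^ n := by
  have h : ∀ a : Fin n → Fin k, 1 ≤ lonelyCount n k a ↔ ¬ NoLonely a := by
    intro a
    rw [lonelyCount, Nat.one_le_iff_ne_zero, Finset.card_ne_zero, Finset.filter_nonempty_iff]
    simp [NoLonely]
  have hcard := Finset.card_filter_add_card_filter_not (s := univ)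
    fun a : Fin n → Fin k => NoLonely a
  rw [Finset.card_univ, Fintype.card_fun, Fintype.card_fin, Fintype.card_fin] at hcard
  have hk' : (k : ℝ) ^ n ≠ 0 := by positivity
  rw [pnk, Fintype.card_subtype, eq_sub_iff_add_eq, ← add_div, div_eq_one_iff_eq hk']
  simp only [h]
  rw [add_comm]
  exact_mod_cast hcard

/-- For every `n ≥ 2` and `k ≥ 1`, the probability that at least one passenger
is lonely is strictly larger with `k + 1` buses than with `k` buses. -/
theorem lonely_prob_strict_mono (n k : ℕ) (hn : 2 ≤ n) (hk : 1 ≤ k) :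
    pnk n k 1 < pnk n (k + 1) 1 := by
  classical
  have : Nontrivial (Fin n) := Fin.nontrivial_iff_two_le.2 hn
  have : Nonempty (Fin k) := ⟨⟨0, hk⟩⟩
  have h := card_noLonely_lt (α := Fin n) (B := Fin k)
  rw [card_noLonely_prod, card_noLonely_finalBus,
    ← card_noLonely_congr (finSuccEquiv k)] at h
  simp only [Fintype.card_fin] at h
  rw [pnk_one n k hk, pnk_one n (k + 1) (by omega)]
  refine sub_lt_sub_left ?_ 1
  rw [div_lt_div_iff₀ (by positivity) (by positivity)]
  norm_cast
  convert h
end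

section
/- For every integer n ≥ 2 and every integer k ≥ 1, the number of lonely passengers with k+1 buses strictly stochastically dominates the number with k buses: for every integer r ≥ 1 one has p_{n,k+1,r} ≥ p_{n,k,r}, and moreover p_{n,k+1,1} > p_{n,k,1}. -/
open Finset

section

open PowerSeries

/-- `f = e ^ X - 1 - X`, the exponential generating function of sets with at least two elements. -/
noncomputable def crowdSeries : PowerSeries ℝ := PowerSeries.exp ℝ - 1 - PowerSeries.X

lemma coeff_crowdSeries (j : ℕ) :
    coeff j crowdSeries = if 2 ≤ j then ((j.factorial : ℝ))⁻¹ else 0 := by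
  unfold crowdSeries
  rcases j with _ | _ | j
  · simp
  · simp [coeff_one, coeff_X]
  · simp [coeff_one, coeff_X, coeff_exp]

lemma derivative_crowdSeries : d⁄dX ℝ crowdSeries = crowdSeries + X := by
  unfold crowdSeries
  simp [PowerSeries.derivative_exp, PowerSeries.derivative_X]

/-- A power series is totally positive of order two if its coefficients are nonnegative and
the `2 × 2` minors of the associated Toeplitz matrix are nonnegative. -/
structure IsTP2 (φ : PowerSeries ℝ) : Prop where
  nonneg : ∀ n, 0 ≤ coeff n φ
  minor : ∀ x₁ x₂ z₁ z₂ : ℕ, x₁ ≤ x₂ → z₁ ≤ z₂ →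
    coeff x₁ (X ^ z₂ * φ) * coeff x₂ (X ^ z₁ * φ) ≤ coeff x₁ (X ^ z₁ * φ) * coeff x₂ (X ^ z₂ * φ)

lemma IsTP2.one : IsTP2 1 where
  nonneg n := by rw [coeff_one]; split_ifs <;> norm_num
  minor x₁ x₂ z₁ z₂ hx hz := by
    simp only [mul_one, coeff_X_pow]
    split_ifs <;> first | omega | norm_num

lemma coeff_X_pow_mul_mul (φ ψ : PowerSeries ℝ) (x y M : ℕ) (hM : x < M) :
    coeff x (X ^ y * (φ * ψ)) =
      ∑ z ∈ range M, coeff x (X ^ z * φ) * coeff z (X ^ y * ψ) := by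
  have h : X ^ y * (φ * ψ) = (X ^ y * ψ) * φ := by ring
  rw [h, coeff_mul, Finset.Nat.sum_antidiagonal_eq_sum_range_succ_mk,
    ← Finset.sum_subset (Finset.range_subset_range.2 hM)]
  · refine Finset.sum_congr rfl fun z hz => ?_
    rw [coeff_X_pow_mul' φ, if_pos (by simpa [Nat.lt_succ_iff] using hz), mul_comm]
  · intro z _ hz
    rw [coeff_X_pow_mul' φ, if_neg (by simpa using hz), zero_mul]

lemma IsTP2.mul {φ ψ : PowerSeries ℝ} (hφ : IsTP2 φ) (hψ : IsTP2 ψ) : IsTP2 (φ * ψ) where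
  nonneg n := by
    rw [coeff_mul]
    exact Finset.sum_nonneg fun p _ => mul_nonneg (hφ.nonneg _) (hψ.nonneg _)
  minor x₁ x₂ y₁ y₂ hx hy := by
    simp only [coeff_X_pow_mul_mul φ ψ x₁ _ (x₂ + 1) (by omega),
      coeff_X_pow_mul_mul φ ψ x₂ _ (x₂ + 1) (by omega)]
    set P : ℕ → ℕ → ℝ := fun x z => coeff x (X ^ z * φ) with hP
    set Q : ℕ → ℕ → ℝ := fun z y => coeff z (X ^ y * ψ) with hQ
    change (∑ z ∈ range (x₂ + 1), P x₁ z * Q z y₂) * (∑ z ∈ range (x₂ + 1), P x₂ z * Q z y₁) ≤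
      (∑ z ∈ range (x₂ + 1), P x₁ z * Q z y₁) * (∑ z ∈ range (x₂ + 1), P x₂ z * Q z y₂)
    have key : 0 ≤ ∑ z ∈ range (x₂ + 1), ∑ t ∈ range (x₂ + 1),
        (P x₁ z * P x₂ t - P x₁ t * P x₂ z) * (Q z y₁ * Q t y₂ - Q z y₂ * Q t y₁) := by
      refine Finset.sum_nonneg fun z _ => Finset.sum_nonneg fun t _ => ?_
      rcases le_total z t with h | h
      · exact mul_nonneg (sub_nonneg.2 (hφ.minor _ _ _ _ hx h))
          (sub_nonneg.2 (hψ.minor _ _ _ _ h hy))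
      · refine mul_nonneg_of_nonpos_of_nonpos (sub_nonpos.2 (hφ.minor _ _ _ _ hx h))
          (sub_nonpos.2 ?_)
        have := hψ.minor _ _ _ _ h hy
        simp only [hQ]
        linarith
    have expand : ∑ z ∈ range (x₂ + 1), ∑ t ∈ range (x₂ + 1),
        (P x₁ z * P x₂ t - P x₁ t * P x₂ z) * (Q z y₁ * Q t y₂ - Q z y₂ * Q t y₁) =
        2 * ((∑ z ∈ range (x₂ + 1), P x₁ z * Q z y₁) * (∑ z ∈ range (x₂ + 1), P x₂ z * Q z y₂) -
        (∑ z ∈ range (x₂ + 1), P x₁ z * Q z y₂) * (∑ z ∈ range (x₂ + 1), P x₂ z * Q z y₁)) := by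
      have hminor : ∀ z t, (P x₁ z * P x₂ t - P x₁ t * P x₂ z) * (Q z y₁ * Q t y₂ - Q z y₂ * Q t y₁) =
          (P x₁ z * Q z y₁) * (P x₂ t * Q t y₂) - (P x₁ z * Q z y₂) * (P x₂ t * Q t y₁)
          - (P x₂ z * Q z y₁) * (P x₁ t * Q t y₂) + (P x₂ z * Q z y₂) * (P x₁ t * Q t y₁) := by
        intro z t; ring
      simp only [hminor, Finset.sum_add_distrib, Finset.sum_sub_distrib, ← Finset.sum_mul_sum]
      ring
    linarith

lemma IsTP2.pow {φ : PowerSeries ℝ} (hφ : IsTP2 φ) (d : ℕ) : IsTP2 (φ ^ d) := by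
  induction d with
  | zero => simpa using IsTP2.one
  | succ d ih => rw [pow_succ]; exact ih.mul hφ

lemma factorial_mul_factorial_le (u p q : ℕ) :
    (u + q).factorial * (u + p).factorial ≤ u.factorial * (u + p + q).factorial := by
  rw [← Nat.factorial_mul_ascFactorial u q, ← Nat.factorial_mul_ascFactorial (u + p) q,
    mul_assoc, mul_comm (Nat.ascFactorial _ _)]
  gcongr
  omega

lemma isTP2_crowdSeries : IsTP2 crowdSeries where
  nonneg n := by rw [coeff_crowdSeries]; split_ifs <;> positivity
  minor x₁ x₂ z₁ z₂ hx hz := by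
    simp only [coeff_X_pow_mul', coeff_crowdSeries]
    by_cases h : z₂ ≤ x₁ ∧ 2 ≤ x₁ - z₂
    · rw [if_pos h.1, if_pos h.2, if_pos (by omega), if_pos (by omega), if_pos (by omega),
        if_pos (by omega), if_pos (by omega), if_pos (by omega), ← mul_inv, ← mul_inv]
      have := factorial_mul_factorial_le (x₁ - z₂) (x₂ - x₁) (z₂ - z₁)
      rw [show x₁ - z₂ + (z₂ - z₁) = x₁ - z₁ by omega,
        show x₁ - z₂ + (x₂ - x₁) = x₂ - z₂ by omega,
        show x₂ - z₂ + (z₂ - z₁) = x₂ - z₁ by omega] at this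
      exact inv_anti₀ (by positivity) (by exact_mod_cast this)
    · have h0 : (if z₂ ≤ x₁ then if 2 ≤ x₁ - z₂ then ((x₁ - z₂).factorial : ℝ)⁻¹ else 0 else 0)
          = 0 := by
        split_ifs <;> first | rfl | (exfalso; exact h ⟨‹_›, ‹_›⟩)
      rw [h0, zero_mul]
      apply mul_nonneg <;> split_ifs <;> positivity

lemma coeff_pow_mul_coeff_pow_le {φ : PowerSeries ℝ} (hφ : IsTP2 φ) {a b m N : ℕ}
    (hab : a ≤ b) (hm : m ≤ N) :
    coeff m (φ ^ b) * coeff N (φ ^ a) ≤ coeff m (φ ^ a) * coeff N (φ ^ b) := by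
  have hb : φ ^ b = X ^ 0 * (φ ^ a * φ ^ (b - a)) := by
    rw [pow_zero, one_mul, ← pow_add, Nat.add_sub_cancel' hab]
  rw [hb, coeff_X_pow_mul_mul _ _ m 0 (N + 1) (by omega),
    coeff_X_pow_mul_mul _ _ N 0 (N + 1) (by omega), Finset.sum_mul, Finset.mul_sum]
  refine Finset.sum_le_sum fun z _ => ?_
  have h := (hφ.pow a).minor m N 0 z hm (Nat.zero_le z)
  have h' := (hφ.pow (b - a)).nonneg z
  simp only [pow_zero, one_mul] at h ⊢
  nlinarith [mul_le_mul_of_nonneg_right h h']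

lemma coeff_pow_mul_coeff_pow_succ_le {φ : PowerSeries ℝ} (hφ : IsTP2 φ) {a b : ℕ}
    (hab : a ≤ b) (N : ℕ) :
    coeff N (φ ^ a) * coeff N (φ ^ (b + 1)) ≤ coeff N (φ ^ (a + 1)) * coeff N (φ ^ b) := by
  rw [pow_succ φ a, pow_succ φ b, coeff_mul, coeff_mul, Finset.sum_mul, Finset.mul_sum]
  refine Finset.sum_le_sum fun p hp => ?_
  have h := coeff_pow_mul_coeff_pow_le hφ hab (m := p.1) (N := N)
    (by rw [HasAntidiagonal.mem_antidiagonal] at hp; omega)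
  have h' := hφ.nonneg p.2
  nlinarith [mul_le_mul_of_nonneg_right h h']

lemma coeff_pow_mul_one_add_pow_le {φ : PowerSeries ℝ} (hφ : IsTP2 φ) (N K : ℕ) :
    ∀ a b : ℕ, a ≤ b →
    coeff N (φ ^ a * (1 + φ) ^ K) * coeff N (φ ^ (b + 1) * (1 + φ) ^ K) ≤
      coeff N (φ ^ (a + 1) * (1 + φ) ^ K) * coeff N (φ ^ b * (1 + φ) ^ K) := by
  induction K with
  | zero => intro a b hab; simpa using coeff_pow_mul_coeff_pow_succ_le hφ hab N
  | succ K ih =>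
    intro a b hab
    have hc : ∀ d, coeff N (φ ^ d * (1 + φ) ^ (K + 1)) =
        coeff N (φ ^ d * (1 + φ) ^ K) + coeff N (φ ^ (d + 1) * (1 + φ) ^ K) := by
      intro d
      rw [← map_add]
      congr 1
      ring
    have h1 := ih a b hab
    have h2 := ih (a + 1) (b + 1) (by omega)
    have h3 : coeff N (φ ^ a * (1 + φ) ^ K) * coeff N (φ ^ (b + 1 + 1) * (1 + φ) ^ K) ≤
        coeff N (φ ^ (a + 1 + 1) * (1 + φ) ^ K) * coeff N (φ ^ b * (1 + φ) ^ K) := by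
      rcases hab.eq_or_lt with rfl | hlt
      · rw [mul_comm]
      · exact (ih a (b + 1) (by omega)).trans (ih (a + 1) b hlt)
    simp only [hc]
    linarith

lemma coeff_one_add_pow_log_concave {φ : PowerSeries ℝ} (hφ : IsTP2 φ) (N K : ℕ) :
    coeff N ((1 + φ) ^ K) * coeff N ((1 + φ) ^ (K + 2)) ≤ coeff N ((1 + φ) ^ (K + 1)) ^ 2 := by
  have h := coeff_pow_mul_one_add_pow_le hφ N K 0 1 zero_le_one
  have e1 : (1 + φ) ^ (K + 1) = φ ^ 0 * (1 + φ) ^ K + φ ^ 1 * (1 + φ) ^ K := by ring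
  have e2 : (1 + φ) ^ (K + 2) = φ ^ 0 * (1 + φ) ^ K + φ ^ 1 * (1 + φ) ^ K
      + (φ ^ 1 * (1 + φ) ^ K + φ ^ (1 + 1) * (1 + φ) ^ K) := by ring
  have e0 : (1 + φ) ^ K = φ ^ 0 * (1 + φ) ^ K := by ring
  rw [e1, e2]
  nth_rewrite 1 [e0]
  simp only [map_add]
  rw [zero_add] at h
  nlinarith

lemma coeff_one_add_pow_nonneg {φ : PowerSeries ℝ} (hφ : IsTP2 φ) (N K : ℕ) :
    0 ≤ coeff N ((1 + φ) ^ K) := by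
  rw [add_comm, add_pow, map_sum]
  refine Finset.sum_nonneg fun d _ => ?_
  rw [one_pow, mul_one, mul_comm, ← nsmul_eq_mul, map_nsmul]
  exact nsmul_nonneg ((hφ.pow d).nonneg N) _

/-- The number of passengers on bus `b`. -/
def load {n k : ℕ} (a : Fin n → Fin k) (b : Fin k) : ℕ :=
  (univ.filter fun p => a p = b).card

/-- The number of buses carrying at least two passengers. -/
def crowdCount (n k : ℕ) (a : Fin n → Fin k) : ℕ :=
  (univ.filter fun b => 2 ≤ load a b).card

lemma load_cons {n k : ℕ} (a : Fin n → Fin k) (b b' : Fin k) :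
    load (Fin.cons b a : Fin (n + 1) → Fin k) b' = load a b' + if b = b' then 1 else 0 := by
  simp only [load, Finset.card_filter, Fin.sum_univ_succ, Fin.cons_zero, Fin.cons_succ]
  rw [add_comm]

lemma lonelyCount_eq_card_load {n k : ℕ} (a : Fin n → Fin k) :
    lonelyCount n k a = (univ.filter fun b => load a b = 1).card := by
  unfold lonelyCount
  have key : ∀ p, (∀ q, q ≠ p → a q ≠ a p) ↔ (univ.filter fun q => a q = a p) = {p} := by
    intro p
    constructor
    · intro h
      ext q
      simp only [mem_filter, mem_univ, true_and, mem_singleton]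
      exact ⟨fun hq => by_contra fun hne => h q hne hq, fun hq => hq ▸ rfl⟩
    · intro h q hne hq
      have : q ∈ (univ.filter fun q => a q = a p) := by simp [hq]
      rw [h] at this
      exact hne (by simpa using this)
  refine Finset.card_bij (fun p _ => a p) ?_ ?_ ?_
  · intro p hp
    simp only [mem_filter, mem_univ, true_and] at hp ⊢
    rw [load, (key p).1 hp, card_singleton]
  · intro p hp q hq hpq
    simp only [mem_filter, mem_univ, true_and] at hp hq
    by_contra hne
    exact hq p hne hpq
  · intro b hb
    simp only [mem_filter, mem_univ, true_and] at hb
    obtain ⟨p, hp⟩ := Finset.card_eq_one.1 hb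
    have hpb : a p = b := by
      have : p ∈ (univ.filter fun q => a q = b) := by rw [hp]; simp
      simpa using this
    refine ⟨p, ?_, hpb⟩
    simp only [mem_filter, mem_univ, true_and]
    rw [key, hpb, hp]

lemma card_filter_update {k : ℕ} (P Q : Fin k → Prop) [DecidablePred P] [DecidablePred Q]
    (b : Fin k) (h : ∀ b', b' ≠ b → (P b' ↔ Q b')) :
    (univ.filter P).card + (if Q b then 1 else 0) = (univ.filter Q).card + if P b then 1 else 0 := by
  simp only [Finset.card_filter]
  rw [← Finset.add_sum_erase univ _ (mem_univ b), ← Finset.add_sum_erase univ _ (mem_univ b)]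
  have : ∑ x ∈ univ.erase b, (if P x then 1 else 0) = ∑ x ∈ univ.erase b, if Q x then 1 else 0 :=
    Finset.sum_congr rfl fun x hx => by simp [h x (Finset.ne_of_mem_erase hx)]
  rw [this]
  ring

lemma lonelyCount_cons {n k : ℕ} (a : Fin n → Fin k) (b : Fin k) :
    lonelyCount (n + 1) k (Fin.cons b a) + (if load a b = 1 then 1 else 0) =
      lonelyCount n k a + if load a b = 0 then 1 else 0 := by
  rw [lonelyCount_eq_card_load, lonelyCount_eq_card_load]
  have h := card_filter_update (fun b' => load (Fin.cons b a : Fin (n + 1) → Fin k) b' = 1)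
    (fun b' => load a b' = 1) b (fun b' hb' => by simp [load_cons, hb'.symm])
  simpa [load_cons] using h

lemma crowdCount_cons {n k : ℕ} (a : Fin n → Fin k) (b : Fin k) :
    crowdCount (n + 1) k (Fin.cons b a) =
      crowdCount n k a + if load a b = 1 then 1 else 0 := by
  have h := card_filter_update (fun b' => 2 ≤ load (Fin.cons b a : Fin (n + 1) → Fin k) b')
    (fun b' => 2 ≤ load a b') b (fun b' hb' => by simp [load_cons, hb'.symm])
  simp only [load_cons, if_true] at h
  unfold crowdCount
  simp only [load_cons]
  split_ifs at h ⊢ <;> omega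

lemma card_load_eq_zero {n k : ℕ} (a : Fin n → Fin k) :
    (univ.filter fun b => load a b = 0).card + lonelyCount n k a + crowdCount n k a = k := by
  rw [lonelyCount_eq_card_load, crowdCount]
  simp only [Finset.card_filter, ← Finset.sum_add_distrib]
  have : ∀ b, ((if load a b = 0 then 1 else 0) + (if load a b = 1 then 1 else 0) +
      if 2 ≤ load a b then 1 else 0) = 1 := by
    intro b; split_ifs <;> omega
  simp [this]

lemma lonelyCount_le {n k : ℕ} (a : Fin n → Fin k) : lonelyCount n k a ≤ n := by
  simpa [lonelyCount] using Finset.card_filter_le (univ : Finset (Fin n)) _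

/-- The sum of a statistic of the numbers of lonely passengers and of crowded buses over all
distributions of `n` passengers on `k` buses. -/
noncomputable def busSum (k n : ℕ) (h : ℕ → ℕ → ℝ) : ℝ :=
  ∑ a : Fin n → Fin k, h (lonelyCount n k a) (crowdCount n k a)

lemma busSum_succ (k n : ℕ) (h : ℕ → ℕ → ℝ) :
    busSum k (n + 1) h = busSum k n fun l d =>
      ((k : ℝ) - l - d) * h (l + 1) d + l * h (l - 1) (d + 1) + d * h l d := by
  unfold busSum
  rw [← (Fin.consEquiv fun _ => Fin k).sum_comp, Fintype.sum_prod_type_right]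
  refine Finset.sum_congr rfl fun a _ => ?_
  set l := lonelyCount n k a with hl
  set d := crowdCount n k a with hd
  have hterm : ∀ b : Fin k, h (lonelyCount (n + 1) k (Fin.cons b a))
      (crowdCount (n + 1) k (Fin.cons b a)) =
      (if load a b = 0 then 1 else 0) * h (l + 1) d +
      (if load a b = 1 then 1 else 0) * h (l - 1) (d + 1) +
      (if 2 ≤ load a b then 1 else 0) * h l d := by
    intro b
    have h1 := lonelyCount_cons a b
    have h2 := crowdCount_cons a b
    rw [← hl] at h1
    rw [← hd] at h2
    rcases lt_trichotomy (load a b) 1 with h0 | h0 | h0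
    · have h0 : load a b = 0 := by omega
      simp only [h0] at h1 h2 ⊢
      simp at h1 h2
      simp [h1, h2]
    · simp only [h0] at h1 h2 ⊢
      simp at h1 h2
      rw [h2, show lonelyCount (n + 1) k (Fin.cons b a) = l - 1 by omega]
      simp
    · have e0 : load a b ≠ 0 := by omega
      have e1 : load a b ≠ 1 := by omega
      simp only [e0, e1, if_false, add_zero] at h1 h2
      rw [h1, h2, if_neg e0, if_neg e1, if_pos (by omega)]
      ring
  change ∑ b, h (lonelyCount (n + 1) k (Fin.cons b a)) (crowdCount (n + 1) k (Fin.cons b a)) = _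
  simp only [hterm, Finset.sum_add_distrib, ← Finset.sum_mul]
  have hk : ((univ.filter fun b => load a b = 0).card : ℝ) = (k : ℝ) - l - d := by
    have := card_load_eq_zero a
    rw [← hl, ← hd] at this
    have h : ((univ.filter fun b => load a b = 0).card : ℝ) + l + d = k := by exact_mod_cast this
    linarith
  have hl' := lonelyCount_eq_card_load a
  rw [← hl] at hl'
  rw [Finset.sum_boole, Finset.sum_boole, Finset.sum_boole, hk, ← hl']
  rfl

lemma factorial_mul_coeff_succ (n l d : ℕ) :
    ((n + 1).factorial : ℝ) * coeff (n + 1) (X ^ l * crowdSeries ^ d) =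
      n.factorial * (l * coeff n (X ^ (l - 1) * crowdSeries ^ d) +
        d * coeff n (X ^ l * crowdSeries ^ d) +
        d * coeff n (X ^ (l + 1) * crowdSeries ^ (d - 1))) := by
  have h1 : ((n + 1).factorial : ℝ) * coeff (n + 1) (X ^ l * crowdSeries ^ d) =
      n.factorial * coeff n (d⁄dX ℝ (X ^ l * crowdSeries ^ d)) := by
    rw [PowerSeries.coeff_derivative, Nat.factorial_succ]
    push_cast
    ring
  have h2 : d⁄dX ℝ (X ^ l * crowdSeries ^ d) =
      l • (X ^ (l - 1) * crowdSeries ^ d) + d • (X ^ l * crowdSeries ^ d) +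
        d • (X ^ (l + 1) * crowdSeries ^ (d - 1)) := by
    rw [Derivation.leibniz, Derivation.leibniz_pow, Derivation.leibniz_pow,
      derivative_crowdSeries, PowerSeries.derivative_X]
    rcases d with _ | d
    · simp [mul_comm]
    · simp only [smul_eq_mul, nsmul_eq_mul, Nat.add_sub_cancel]
      ring
  rw [h1, h2]
  simp only [map_add, map_nsmul]
  simp only [nsmul_eq_mul]

lemma sum_range_lonely_shift (k : ℕ) (W h : ℕ → ℝ) (d : ℕ) :
    ∑ l ∈ range (k + 1), (k.choose l * (k - l).choose d : ℝ) * (l * W (l - 1)) * h l =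
      ∑ l ∈ range (k + 1), (k.choose l * (k - l).choose d : ℝ) * W l *
        (((k : ℝ) - l - d) * h (l + 1)) := by
  rw [Finset.sum_range_succ', Finset.sum_range_succ]
  have hlast : (k.choose k * (k - k).choose d : ℝ) * W k * (((k : ℝ) - k - d) * h (k + 1)) = 0 := by
    rcases d with _ | d <;> simp
  rw [hlast]
  simp only [Nat.cast_zero, zero_mul, mul_zero]
  congr 1
  refine Finset.sum_congr rfl fun l hl => ?_
  obtain ⟨m, rfl⟩ : ∃ m, k = l + 1 + m := Nat.exists_eq_add_of_lt (by simpa using hl) |>.imp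
    fun m hm => by omega
  have e1 : ((l + 1 + m).choose (l + 1) : ℝ) * (l + 1) = (l + 1 + m).choose l * (m + 1) := by
    have := Nat.choose_succ_right_eq (l + 1 + m) l
    rw [show l + 1 + m - l = m + 1 by omega] at this
    exact_mod_cast this
  have e2 : ((m + 1).choose d : ℝ) * (m + 1 - d) = (m + 1) * m.choose d := by
    have h := Nat.choose_mul_succ_eq m d
    rcases le_or_gt d (m + 1) with hd | hd
    · have h' : ((m.choose d * (m + 1) : ℕ) : ℝ) = ((m + 1).choose d * (m + 1 - d) : ℕ) := by
        rw [h]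
      push_cast [Nat.cast_sub hd] at h'
      linarith
    · rw [Nat.choose_eq_zero_of_lt hd, Nat.choose_eq_zero_of_lt (by omega)]
      simp
  rw [show l + 1 + m - (l + 1) = m by omega, show l + 1 + m - l = m + 1 by omega,
    Nat.add_sub_cancel]
  push_cast
  linear_combination (m.choose d : ℝ) * W l * h (l + 1) * e1 -
    ((l + 1 + m).choose l : ℝ) * W l * h (l + 1) * e2

lemma sum_range_crowd_shift (k : ℕ) (W h : ℕ → ℕ → ℝ) :
    ∑ l ∈ range (k + 1), ∑ d ∈ range (k + 1),
        (k.choose l * (k - l).choose d : ℝ) * (d * W (l + 1) (d - 1)) * h l d =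
      ∑ l ∈ range (k + 1), ∑ d ∈ range (k + 1),
        (k.choose l * (k - l).choose d : ℝ) * W l d * (l * h (l - 1) (d + 1)) := by
  conv_lhs => rw [Finset.sum_range_succ]
  conv_rhs => rw [Finset.sum_range_succ']
  have h0 : ∑ d ∈ range (k + 1), (k.choose 0 * (k - 0).choose d : ℝ) * W 0 d *
      (((0 : ℕ) : ℝ) * h (0 - 1) (d + 1)) = 0 := Finset.sum_eq_zero fun d _ => by simp
  have hk : ∑ d ∈ range (k + 1), (k.choose k * (k - k).choose d : ℝ) *
      (d * W (k + 1) (d - 1)) * h k d = 0 :=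
    Finset.sum_eq_zero fun d _ => by rcases d with _ | d <;> simp
  rw [h0, hk]
  congr 1
  refine Finset.sum_congr rfl fun l hl => ?_
  obtain ⟨m, rfl⟩ : ∃ m, k = l + 1 + m := Nat.exists_eq_add_of_lt (by simpa using hl) |>.imp
    fun m hm => by omega
  rw [Finset.sum_range_succ', Finset.sum_range_succ]
  have h0' : ((l + 1 + m).choose l * (l + 1 + m - l).choose 0 : ℝ) *
      (((0 : ℕ) : ℝ) * W (l + 1) (0 - 1)) * h l 0 = 0 := by simp
  rw [h0', Nat.choose_eq_zero_of_lt (show l + 1 + m - (l + 1) < l + 1 + m by omega)]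
  simp only [Nat.cast_zero, mul_zero, zero_mul]
  congr 1
  refine Finset.sum_congr rfl fun d _ => ?_
  rw [show l + 1 + m - (l + 1) = m by omega, show l + 1 + m - l = m + 1 by omega]
  have e1 : ((l + 1 + m).choose (l + 1) : ℝ) * (l + 1) = (l + 1 + m).choose l * (m + 1) := by
    have := Nat.choose_succ_right_eq (l + 1 + m) l
    rw [show l + 1 + m - l = m + 1 by omega] at this
    exact_mod_cast this
  have e2 : ((m : ℝ) + 1) * m.choose d = (m + 1).choose (d + 1) * (d + 1) := by
    exact_mod_cast Nat.add_one_mul_choose_eq m d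
  simp only [Nat.add_sub_cancel]
  push_cast
  linear_combination -((m.choose d : ℝ) * W (l + 1) d * h l (d + 1)) * e1 -
    ((l + 1 + m).choose l : ℝ) * W (l + 1) d * h l (d + 1) * e2

lemma busSum_zero (k : ℕ) (h : ℕ → ℕ → ℝ) : busSum k 0 h = h 0 0 := by
  unfold busSum
  rw [Fintype.sum_unique]
  congr 1
  simp [crowdCount, load]

lemma coeff_zero_mul_crowdSeries_pow (l d : ℕ) :
    coeff 0 (X ^ l * crowdSeries ^ d) = if l = 0 ∧ d = 0 then 1 else 0 := by
  have hf : constantCoeff crowdSeries = 0 := by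
    rw [← coeff_zero_eq_constantCoeff_apply, coeff_crowdSeries]; simp
  rw [coeff_zero_eq_constantCoeff_apply, map_mul, map_pow, map_pow, hf, constantCoeff_X]
  rcases l with _ | l <;> rcases d with _ | d <;> simp

theorem busSum_eq (k n : ℕ) (h : ℕ → ℕ → ℝ) :
    busSum k n h = ∑ l ∈ range (k + 1), ∑ d ∈ range (k + 1),
      (k.choose l * (k - l).choose d : ℝ) *
        (n.factorial * coeff n (X ^ l * crowdSeries ^ d)) * h l d := by
  induction n generalizing h with
  | zero =>
    rw [busSum_zero, Finset.sum_eq_single 0, Finset.sum_eq_single 0]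
    · simp
    · intro d _ hd; simp only [coeff_zero_mul_crowdSeries_pow]; simp [hd]
    · simp
    · intro l _ hl
      exact Finset.sum_eq_zero fun d _ => by
        simp only [coeff_zero_mul_crowdSeries_pow]; simp [hl]
    · simp
  | succ n ih =>
    rw [busSum_succ, ih]
    set W : ℕ → ℕ → ℝ := fun l d => n.factorial * coeff n (X ^ l * crowdSeries ^ d) with hW
    have hstep : ∀ l d, ((n + 1).factorial : ℝ) * coeff (n + 1) (X ^ l * crowdSeries ^ d) =
        l * W (l - 1) d + d * W l d + d * W (l + 1) (d - 1) := by
      intro l d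
      rw [factorial_mul_coeff_succ]
      simp only [hW]
      ring
    simp only [hstep, mul_add, add_mul, Finset.sum_add_distrib]
    have hl : ∑ l ∈ range (k + 1), ∑ d ∈ range (k + 1),
        (k.choose l * (k - l).choose d : ℝ) * (l * W (l - 1) d) * h l d =
        ∑ l ∈ range (k + 1), ∑ d ∈ range (k + 1),
          (k.choose l * (k - l).choose d : ℝ) * W l d * (((k : ℝ) - l - d) * h (l + 1) d) := by
      rw [Finset.sum_comm]
      conv_rhs => rw [Finset.sum_comm]
      exact Finset.sum_congr rfl fun d _ =>
        sum_range_lonely_shift k (fun l => W l d) (fun l => h l d) d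
    rw [sum_range_crowd_shift k W h, hl]
    have e : ∀ l d : ℕ, (k.choose l * (k - l).choose d : ℝ) * (d * W l d) * h l d =
        (k.choose l * (k - l).choose d : ℝ) * W l d * (d * h l d) := by intros; ring
    simp only [e]
    ring

lemma sum_choose_mul_coeff (n l K M : ℕ) (hK : K < M) :
    ∑ d ∈ range M, (K.choose d : ℝ) * coeff n (X ^ l * crowdSeries ^ d) =
      coeff n (X ^ l * (1 + crowdSeries) ^ K) := by
  rw [add_comm, add_pow, Finset.mul_sum, map_sum,
    ← Finset.sum_subset (Finset.range_subset_range.2 hK)]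
  · refine Finset.sum_congr rfl fun d _ => ?_
    rw [one_pow, mul_one, ← mul_assoc, mul_comm _ ((K.choose d : ℕ) : PowerSeries ℝ),
      ← nsmul_eq_mul, ← nsmul_eq_mul, map_nsmul]
  · intro d _ hd
    rw [Nat.choose_eq_zero_of_lt (by simpa using hd)]
    simp

lemma busSum_lonely_eq (k n l : ℕ) :
    busSum k n (fun l' _ => if l' = l then 1 else 0) =
      k.choose l * n.factorial * coeff n (X ^ l * (1 + crowdSeries) ^ (k - l)) := by
  rw [busSum_eq, Finset.sum_comm]
  simp only [mul_ite, mul_one, mul_zero, Finset.sum_ite_eq', mem_range]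
  split_ifs with hl
  · rw [← sum_choose_mul_coeff n l (k - l) (k + 1) (by omega), Finset.mul_sum]
    exact Finset.sum_congr rfl fun d _ => by ring
  · rw [Nat.choose_eq_zero_of_lt (by omega)]
    simp

lemma busSum_lonely_empty (k n l : ℕ) :
    busSum k n (fun l' d => if l' = l then (k : ℝ) - l' - d else 0) =
      k.choose l * (k - l : ℕ) * n.factorial *
        coeff n (X ^ l * (1 + crowdSeries) ^ (k - l - 1)) := by
  rw [busSum_eq, Finset.sum_comm]
  simp only [mul_ite, mul_zero, Finset.sum_ite_eq', mem_range]
  split_ifs with hl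
  · rw [← sum_choose_mul_coeff n l (k - l - 1) (k + 1) (by omega), Finset.mul_sum]
    refine Finset.sum_congr rfl fun d _ => ?_
    have hc : ((k - l).choose d : ℝ) * ((k : ℝ) - l - d) =
        (k - l : ℕ) * (k - l - 1).choose d := by
      rw [← Nat.cast_sub (by omega : l ≤ k)]
      rcases hm : k - l with _ | m
      · rcases d with _ | d <;> simp
      · have h := Nat.choose_mul_succ_eq m d
        rw [Nat.add_sub_cancel]
        rcases le_or_gt d (m + 1) with hd | hd
        · have h' : ((m.choose d * (m + 1) : ℕ) : ℝ) = ((m + 1).choose d * (m + 1 - d) : ℕ) := by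
            rw [h]
          push_cast [Nat.cast_sub hd] at h' ⊢
          linarith
        · rw [Nat.choose_eq_zero_of_lt hd, Nat.choose_eq_zero_of_lt (by omega)]
          simp
    linear_combination (k.choose l * (n.factorial * coeff n (X ^ l * crowdSeries ^ d)) : ℝ) * hc
  · rw [Nat.choose_eq_zero_of_lt (by omega)]
    simp

/-- The probability that exactly `l` of the `n` passengers on `k` buses are lonely. -/
noncomputable def lonelyProb (n k l : ℕ) : ℝ :=
  busSum k n (fun l' _ => if l' = l then 1 else 0) / (k : ℝ) ^ n

/-- The probability that exactly `l` of the `n` passengers on `k` buses are lonely and an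
additional passenger chooses an empty bus. -/
noncomputable def lonelyEmptyProb (n k l : ℕ) : ℝ :=
  busSum k n (fun l' d => if l' = l then (k : ℝ) - l' - d else 0) / (k : ℝ) ^ (n + 1)

lemma pnk_eq_busSum (n k r : ℕ) :
    pnk n k r = busSum k n (fun l _ => if r ≤ l then 1 else 0) / (k : ℝ) ^ n := by
  rw [pnk, busSum, Finset.sum_boole]

lemma pnk_nonneg (n k r : ℕ) : 0 ≤ pnk n k r := by unfold pnk; positivity

lemma pnk_zero_right (n : ℕ) {k : ℕ} (hk : 1 ≤ k) : pnk n k 0 = 1 := by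
  have hk0 : (k : ℝ) ≠ 0 := by positivity
  simp [pnk, hk0]

lemma pnk_zero_left (k : ℕ) {r : ℕ} (hr : 1 ≤ r) : pnk 0 k r = 0 := by
  rw [pnk_eq_busSum, busSum_zero, if_neg (by omega), zero_div]

lemma pnk_of_lt {n k r : ℕ} (h : n < r) : pnk n k r = 0 := by
  rw [pnk_eq_busSum, busSum, Finset.sum_eq_zero, zero_div]
  intro a _
  have := lonelyCount_le a
  rw [if_neg (by omega)]

lemma pnk_of_bus_lt {n k r : ℕ} (h : k < r) : pnk n k r = 0 := by
  rw [pnk_eq_busSum, busSum, Finset.sum_eq_zero, zero_div]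
  intro a _
  have := card_load_eq_zero a
  rw [if_neg (by omega)]

lemma lonelyProb_eq_sub (n k l : ℕ) : lonelyProb n k l = pnk n k l - pnk n k (l + 1) := by
  rw [lonelyProb, pnk_eq_busSum, pnk_eq_busSum, ← sub_div]
  simp only [busSum]
  rw [← Finset.sum_sub_distrib]
  congr 1
  refine Finset.sum_congr rfl fun a _ => ?_
  split_ifs <;> first | omega | norm_num

lemma pnk_succ {k : ℕ} (hk : 1 ≤ k) (n r : ℕ) :
    pnk (n + 1) k (r + 1) = pnk n k (r + 1) - (r + 1) / k * lonelyProb n k (r + 1) +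
      lonelyEmptyProb n k r := by
  have hk0 : (k : ℝ) ≠ 0 := by positivity
  have hsum : busSum k (n + 1) (fun l _ => if r + 1 ≤ l then 1 else 0) =
      k * busSum k n (fun l _ => if r + 1 ≤ l then 1 else 0) -
      (r + 1) * busSum k n (fun l _ => if l = r + 1 then 1 else 0) +
      busSum k n (fun l d => if l = r then (k : ℝ) - l - d else 0) := by
    rw [busSum_succ]
    simp only [busSum]
    rw [Finset.mul_sum, Finset.mul_sum, ← Finset.sum_sub_distrib, ← Finset.sum_add_distrib]
    refine Finset.sum_congr rfl fun a _ => ?_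
    generalize lonelyCount n k a = l
    generalize crowdCount n k a = d
    rcases lt_trichotomy l (r + 1) with h | h | h
    · rw [if_neg (show ¬ r + 1 ≤ l - 1 by omega), if_neg (show ¬ r + 1 ≤ l by omega),
        if_neg (show ¬ l = r + 1 by omega)]
      by_cases hr : l = r
      · rw [if_pos (by omega), if_pos hr]; ring
      · rw [if_neg (by omega), if_neg hr]; ring
    · subst h
      simp
    · rw [if_pos (by omega), if_pos (by omega), if_pos (by omega), if_neg (by omega),
        if_neg (by omega)]
      ring
  rw [pnk_eq_busSum, hsum, pnk_eq_busSum, lonelyProb, lonelyEmptyProb]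
  field_simp
  ring

lemma one_le_crowdCount {n k : ℕ} (a : Fin n → Fin k) (h : lonelyCount n k a < n) :
    1 ≤ crowdCount n k a := by
  have hex : ∃ p, ¬ ∀ q, q ≠ p → a q ≠ a p := by
    by_contra! hall
    have : lonelyCount n k a = n := by
      rw [lonelyCount, Finset.filter_true_of_mem fun p _ => hall p]
      simp
    omega
  push Not at hex
  obtain ⟨p, q, hqp, hq⟩ := hex
  refine Finset.card_pos.2 ⟨a p, ?_⟩
  simp only [mem_filter, mem_univ, true_and]
  exact Finset.one_lt_card.2 ⟨q, by simp [hq], p, by simp, hqp⟩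

lemma lonelyProb_nonneg (n k l : ℕ) : 0 ≤ lonelyProb n k l := by
  unfold lonelyProb busSum
  exact div_nonneg (Finset.sum_nonneg fun a _ => by dsimp only; split_ifs <;> norm_num) (by positivity)

lemma lonelyEmptyProb_nonneg (n k l : ℕ) : 0 ≤ lonelyEmptyProb n k l := by
  unfold lonelyEmptyProb busSum
  refine div_nonneg (Finset.sum_nonneg fun a _ => ?_) (by positivity)
  have h : ((lonelyCount n k a + crowdCount n k a : ℕ) : ℝ) ≤ k := by
    have := card_load_eq_zero a
    exact_mod_cast (by omega : lonelyCount n k a + crowdCount n k a ≤ k)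
  push_cast at h
  dsimp only
  split_ifs <;> linarith

lemma lonelyEmptyProb_le {k : ℕ} (hk : 1 ≤ k) (n l : ℕ) :
    lonelyEmptyProb n k l ≤ lonelyProb n k l := by
  have hk0 : (0 : ℝ) < k := by positivity
  have h : lonelyProb n k l =
      (k * busSum k n (fun l' _ => if l' = l then 1 else 0)) / (k : ℝ) ^ (n + 1) := by
    rw [lonelyProb]; field_simp; ring
  rw [h, lonelyEmptyProb]
  gcongr
  simp only [busSum]
  rw [Finset.mul_sum]
  refine Finset.sum_le_sum fun a _ => ?_
  split_ifs
  · have h1 : (0 : ℝ) ≤ lonelyCount n k a := by positivity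
    have h2 : (0 : ℝ) ≤ crowdCount n k a := by positivity
    linarith
  · simp

lemma lonelyEmptyProb_le_of_lt {k : ℕ} (hk : 1 ≤ k) {n l : ℕ} (hl : l < n) :
    lonelyEmptyProb n k l ≤ (1 - (l + 1) / k) * lonelyProb n k l := by
  have hk0 : (0 : ℝ) < k := by positivity
  have h : (1 - (l + 1) / k) * lonelyProb n k l =
      ((k - l - 1) * busSum k n (fun l' _ => if l' = l then 1 else 0)) / (k : ℝ) ^ (n + 1) := by
    rw [lonelyProb]; field_simp; ring
  rw [h, lonelyEmptyProb]
  gcongr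
  simp only [busSum]
  rw [Finset.mul_sum]
  refine Finset.sum_le_sum fun a _ => ?_
  split_ifs with ha
  · have h2 : (1 : ℝ) ≤ crowdCount n k a := by exact_mod_cast one_le_crowdCount a (by omega)
    rw [ha]
    linarith
  · simp

lemma coeff_X_pow_mul_log_concave (n l K : ℕ) :
    coeff n (X ^ l * (1 + crowdSeries) ^ K) * coeff n (X ^ l * (1 + crowdSeries) ^ (K + 2)) ≤
      coeff n (X ^ l * (1 + crowdSeries) ^ (K + 1)) ^ 2 := by
  simp only [coeff_X_pow_mul']
  split_ifs
  · exact coeff_one_add_pow_log_concave isTP2_crowdSeries _ _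
  · simp

/-- Given the number of lonely passengers, a new passenger is more likely to find an empty bus if
there is one more bus. -/
lemma lonelyEmptyProb_mul_lonelyProb_le {k : ℕ} (hk : 1 ≤ k) (n l : ℕ) :
    lonelyEmptyProb n k l * lonelyProb n (k + 1) l ≤
      lonelyEmptyProb n (k + 1) l * lonelyProb n k l := by
  rcases le_or_gt k l with hl | hl
  · have : lonelyEmptyProb n k l = 0 := by
      rw [lonelyEmptyProb, busSum_lonely_empty, Nat.sub_eq_zero_of_le hl]; simp
    rw [this, zero_mul]
    exact mul_nonneg (lonelyEmptyProb_nonneg _ _ _) (lonelyProb_nonneg _ _ _)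
  · obtain ⟨m, rfl⟩ : ∃ m, k = l + 1 + m := ⟨k - (l + 1), by omega⟩
    simp only [lonelyEmptyProb, lonelyProb, busSum_lonely_empty, busSum_lonely_eq]
    rw [show l + 1 + m - l - 1 = m by omega, show l + 1 + m - l = m + 1 by omega,
      show l + 1 + m + 1 - l - 1 = m + 1 by omega, show l + 1 + m + 1 - l = m + 2 by omega]
    have hlc := coeff_X_pow_mul_log_concave n l m
    set c₀ := coeff n (X ^ l * (1 + crowdSeries) ^ m)
    set c₁ := coeff n (X ^ l * (1 + crowdSeries) ^ (m + 1))
    set c₂ := coeff n (X ^ l * (1 + crowdSeries) ^ (m + 2))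
    set k := l + 1 + m with hkdef
    have hk0 : (0 : ℝ) < k := by positivity
    have hfrac : ((m + 1 : ℕ) : ℝ) / k ≤ ((m + 2 : ℕ) : ℝ) / (k + 1 : ℕ) := by
      rw [div_le_div_iff₀ hk0 (by positivity), hkdef]
      push_cast
      have : (0 : ℝ) ≤ l := by positivity
      nlinarith
    have hmul : ((m + 1 : ℕ) : ℝ) / k * (c₀ * c₂) ≤ ((m + 2 : ℕ) : ℝ) / (k + 1 : ℕ) * c₁ ^ 2 :=
      (mul_le_mul_of_nonneg_left hlc (by positivity)).trans
        (mul_le_mul_of_nonneg_right hfrac (sq_nonneg _))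
    have hcoef : (0 : ℝ) ≤ k.choose l * (k + 1).choose l * n.factorial ^ 2 /
        ((k : ℝ) ^ n * ((k + 1 : ℕ) : ℝ) ^ n) := by positivity
    have := mul_le_mul_of_nonneg_left hmul hcoef
    calc _ = _ := ?_
      _ ≤ _ := this
      _ = _ := ?_
    · field_simp
      ring
    · field_simp
      ring

lemma pnk_succ_add_le {k : ℕ} (hk : 1 ≤ k) {n r : ℕ} (hr : r + 1 ≤ k)
    (ih : ∀ s, pnk n k s ≤ pnk n (k + 1) s) :
    pnk (n + 1) k (r + 1) + ((r + 1) / k - (r + 1) / (k + 1 : ℕ)) * lonelyProb n (k + 1) (r + 1) ≤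
      pnk (n + 1) (k + 1) (r + 1) := by
  have hk0 : (0 : ℝ) < k := by positivity
  rw [pnk_succ hk, pnk_succ (Nat.le_add_left 1 k)]
  have hcross := lonelyEmptyProb_mul_lonelyProb_le hk n r
  have hle := lonelyEmptyProb_le hk n r
  have he := lonelyEmptyProb_nonneg n k r
  have he' := lonelyEmptyProb_nonneg n (k + 1) r
  obtain ⟨u, hu0, hu, hue', hstay⟩ : ∃ u : ℝ, 0 ≤ u ∧ lonelyEmptyProb n k r = u * lonelyProb n k r ∧
      u * lonelyProb n (k + 1) r ≤ lonelyEmptyProb n (k + 1) r ∧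
      (r < n → 0 ≤ 1 - (r + 1) / k - u) := by
    rcases (lonelyProb_nonneg n k r).eq_or_lt with h0 | hpos
    · refine ⟨0, le_rfl, by rw [zero_mul]; linarith, by rwa [zero_mul], fun _ => ?_⟩
      have : ((r : ℝ) + 1) / k ≤ 1 := by
        rw [div_le_one hk0]; exact_mod_cast hr
      linarith
    · refine ⟨lonelyEmptyProb n k r / lonelyProb n k r, by positivity, by field_simp, ?_, ?_⟩
      · rw [div_mul_eq_mul_div, div_le_iff₀ hpos]; exact hcross
      · intro hrn
        have := lonelyEmptyProb_le_of_lt hk hrn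
        rw [← div_le_iff₀ hpos] at this
        linarith
  have hw := lonelyProb_eq_sub n k r
  have hw1 := lonelyProb_eq_sub n k (r + 1)
  have hw' := lonelyProb_eq_sub n (k + 1) r
  have hw1' := lonelyProb_eq_sub n (k + 1) (r + 1)
  have hmid : 0 ≤ (1 - (r + 1) / k - u) * (pnk n (k + 1) (r + 1) - pnk n k (r + 1)) := by
    rcases lt_or_ge r n with h | h
    · exact mul_nonneg (hstay h) (sub_nonneg.2 (ih _))
    · rw [pnk_of_lt (by omega), pnk_of_lt (by omega)]; simp
  have hlow : 0 ≤ u * (pnk n (k + 1) r - pnk n k r) := mul_nonneg hu0 (sub_nonneg.2 (ih _))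
  have hhigh : 0 ≤ ((r : ℝ) + 1) / k * (pnk n (k + 1) (r + 1 + 1) - pnk n k (r + 1 + 1)) :=
    mul_nonneg (by positivity) (sub_nonneg.2 (ih _))
  rw [hu, hw, hw1]
  rw [hw'] at hue'
  rw [hw1']
  linarith

lemma succ_div_cast_succ_lt {k : ℕ} (hk : 1 ≤ k) (r : ℕ) :
    ((r : ℝ) + 1) / (k + 1 : ℕ) < (r + 1) / k := by
  have hk0 : (0 : ℝ) < k := by positivity
  gcongr
  simp

lemma pnk_le_pnk_succ {k : ℕ} (hk : 1 ≤ k) (n : ℕ) : ∀ r, pnk n k r ≤ pnk n (k + 1) r := by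
  induction n with
  | zero =>
    rintro (_ | r)
    · rw [pnk_zero_right _ hk, pnk_zero_right _ (Nat.le_add_left 1 k)]
    · rw [pnk_zero_left _ (by omega), pnk_zero_left _ (by omega)]
  | succ n ih =>
    rintro (_ | r)
    · rw [pnk_zero_right _ hk, pnk_zero_right _ (Nat.le_add_left 1 k)]
    · rcases le_or_gt (r + 1) k with hr | hr
      · have := pnk_succ_add_le hk hr ih
        have h2 := mul_nonneg (sub_nonneg.2 (succ_div_cast_succ_lt hk r).le)
          (lonelyProb_nonneg n (k + 1) (r + 1))
        linarith
      · rw [pnk_of_bus_lt hr]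
        exact pnk_nonneg _ _ _

lemma coeff_one_add_crowdSeries_pow_pos {N : ℕ} (hN : 2 ≤ N) (j : ℕ) :
    0 < coeff N ((1 + crowdSeries) ^ (j + 1)) := by
  induction j with
  | zero =>
    rw [zero_add, pow_one, map_add, coeff_one, if_neg (by omega), coeff_crowdSeries, if_pos hN]
    positivity
  | succ j ih =>
    rw [pow_succ, mul_add, mul_one, map_add]
    refine add_pos_of_pos_of_nonneg ih ?_
    rw [coeff_mul]
    exact Finset.sum_nonneg fun p _ => mul_nonneg
      (coeff_one_add_pow_nonneg isTP2_crowdSeries _ _) (isTP2_crowdSeries.nonneg _)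

lemma coeff_one_add_crowdSeries_pow (k : ℕ) :
    coeff 0 ((1 + crowdSeries) ^ k) = 1 ∧ coeff 1 ((1 + crowdSeries) ^ k) = 0 ∧
      coeff 2 ((1 + crowdSeries) ^ k) = (k : ℝ) / 2 ∧ coeff 3 ((1 + crowdSeries) ^ k) = (k : ℝ) / 6 := by
  induction k with
  | zero => simp [coeff_one]
  | succ k ih =>
    obtain ⟨h0, h1, h2, h3⟩ := ih
    simp only [pow_succ, mul_add, mul_one, map_add, coeff_mul,
      Finset.Nat.sum_antidiagonal_eq_sum_range_succ_mk, Finset.sum_range_succ,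
      Finset.sum_range_zero, coeff_crowdSeries, h0, h1, h2, h3]
    norm_num [Nat.factorial]
    constructor <;> ring

lemma pnk_one_eq {k : ℕ} (hk : 1 ≤ k) (n : ℕ) :
    pnk n k 1 = 1 - n.factorial * coeff n ((1 + crowdSeries) ^ k) / (k : ℝ) ^ n := by
  have h := lonelyProb_eq_sub n k 0
  rw [pnk_zero_right n hk, lonelyProb, busSum_lonely_eq] at h
  simp only [Nat.choose_zero_right, Nat.cast_one, one_mul, pow_zero, Nat.sub_zero, zero_add] at h
  linarith

lemma pnk_one_lt_pnk_succ {n k : ℕ} (hn : 2 ≤ n) (hk : 1 ≤ k) :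
    pnk n k 1 < pnk n (k + 1) 1 := by
  have hk0 : (0 : ℝ) < k := by positivity
  obtain rfl | rfl | hn : n = 2 ∨ n = 3 ∨ 4 ≤ n := by omega
  · have hval : ∀ j : ℕ, 1 ≤ j → pnk 2 j 1 = 1 - 1 / j := by
      intro j hj
      have hj0 : (0 : ℝ) < j := by positivity
      rw [pnk_one_eq hj, (coeff_one_add_crowdSeries_pow j).2.2.1]
      norm_num [Nat.factorial]
      field_simp
    rw [hval k hk, hval (k + 1) (by omega)]
    gcongr
    simp
  · have hval : ∀ j : ℕ, 1 ≤ j → pnk 3 j 1 = 1 - 1 / j ^ 2 := by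
      intro j hj
      have hj0 : (0 : ℝ) < j := by positivity
      rw [pnk_one_eq hj, (coeff_one_add_crowdSeries_pow j).2.2.2]
      norm_num [Nat.factorial]
      field_simp
    rw [hval k hk, hval (k + 1) (by omega)]
    gcongr
    simp
  · obtain ⟨m, rfl⟩ : ∃ m, n = m + 2 := ⟨n - 2, by omega⟩
    obtain ⟨j, rfl⟩ : ∃ j, k = j + 1 := ⟨k - 1, by omega⟩
    have h := pnk_succ_add_le hk (r := 0) (n := m + 1) (by omega) (pnk_le_pnk_succ hk (m + 1))
    have hpos : 0 < lonelyProb (m + 1) (j + 1 + 1) (0 + 1) := by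
      rw [lonelyProb, busSum_lonely_eq, zero_add, pow_one, Nat.add_sub_cancel, coeff_succ_X_mul,
        Nat.choose_one_right]
      have := coeff_one_add_crowdSeries_pow_pos (show 2 ≤ m by omega) j
      positivity
    have h2 := mul_pos (sub_pos.2 (succ_div_cast_succ_lt hk 0)) hpos
    linarith

end

/-- For every `n ≥ 2` and `k ≥ 1`, the number of lonely passengers with `k + 1`
buses strictly stochastically dominates the number with `k` buses: for every
`r ≥ 1` one has `p_{n,k,r} ≤ p_{n,k+1,r}`, and moreover
`p_{n,k,1} < p_{n,k+1,1}`. -/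
theorem lonely_stochastic_dominance (n k : ℕ) (hn : 2 ≤ n) (hk : 1 ≤ k) :
    (∀ r : ℕ, 1 ≤ r → pnk n k r ≤ pnk n (k + 1) r) ∧ pnk n k 1 < pnk n (k + 1) 1 := by
  exact ⟨fun r _ => pnk_le_pnk_succ hk n r, pnk_one_lt_pnk_succ hn hk⟩
end

section
/- For every integer n ≥ 2 and every integer k ≥ 1, the expected number of lonely passengers is strictly increasing in the number of buses: E[L_n^(k+1)] > E[L_n^(k)]. -/
open Finset

/-- The expected number of lonely passengers when each of `n` passengers
independently chooses one of `k` buses uniformly at random. -/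
noncomputable def expLonely (n k : ℕ) : ℝ :=
  (∑ a : Fin n → Fin k, (lonelyCount n k a : ℝ)) / ((k : ℝ) ^ n)

lemma card_lonely_at_bus (n k : ℕ) (p : Fin n) (b : Fin k) :
    #{a : Fin n → Fin k | a p = b ∧ ∀ q, q ≠ p → a q ≠ b} = (k - 1) ^ (n - 1) := by
  have h : ({a : Fin n → Fin k | a p = b ∧ ∀ q, q ≠ p → a q ≠ b} : Finset (Fin n → Fin k)) =
      Fintype.piFinset fun q => if q = p then {b} else {b}ᶜ := by
    ext a
    simp only [mem_filter, mem_univ, true_and, Fintype.mem_piFinset]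
    constructor
    · rintro ⟨hp, hq⟩ q
      by_cases hqp : q = p
      · simp [hqp, hp]
      · simpa [hqp] using hq q hqp
    · intro ha
      refine ⟨by simpa using ha p, fun q hqp => ?_⟩
      simpa [hqp] using ha q
  rw [h, Fintype.card_piFinset, ← mul_prod_erase univ _ (mem_univ p),
    prod_congr rfl (g := fun _ => k - 1) fun q hq => by
      simp [ne_of_mem_erase hq, card_compl]]
  simp

lemma card_lonely (n k : ℕ) (p : Fin n) :
    #{a : Fin n → Fin k | ∀ q, q ≠ p → a q ≠ a p} = k * (k - 1) ^ (n - 1) := by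
  rw [card_eq_sum_card_fiberwise (f := fun a => a p) (t := univ) (by simp)]
  have h (b : Fin k) : #{a ∈ ({a : Fin n → Fin k | ∀ q, q ≠ p → a q ≠ a p} : Finset _) | a p = b} =
      (k - 1) ^ (n - 1) := by
    rw [← card_lonely_at_bus n k p b, filter_filter]
    congr 1
    ext a
    simp only [mem_filter, mem_univ, true_and]
    constructor
    · rintro ⟨hq, rfl⟩
      exact ⟨rfl, hq⟩
    · rintro ⟨rfl, hq⟩
      exact ⟨hq, rfl⟩
  simp [h]

lemma sum_lonelyCount (n k : ℕ) :
    ∑ a : Fin n → Fin k, lonelyCount n k a = n * (k * (k - 1) ^ (n - 1)) := by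
  simp only [lonelyCount, card_filter]
  rw [sum_comm]
  simp only [← card_filter, card_lonely]
  simp

lemma expLonely_succ (n k : ℕ) (hn : n ≠ 0) :
    expLonely n (k + 1) = n * (k / (k + 1) : ℝ) ^ (n - 1) := by
  obtain ⟨m, rfl⟩ := Nat.exists_eq_succ_of_ne_zero hn
  have hk : (k + 1 : ℝ) ≠ 0 := by positivity
  rw [expLonely, ← Nat.cast_sum, sum_lonelyCount]
  simp only [Nat.succ_eq_add_one, Nat.add_sub_cancel, div_pow]
  push_cast
  field_simp
  ring

/-- For every `n ≥ 2` and `k ≥ 1`, the expected number of lonely passengers is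
strictly increasing in the number of buses: `E[L_n^(k+1)] > E[L_n^(k)]`. -/
theorem expected_lonely_strict_mono (n k : ℕ) (hn : 2 ≤ n) (hk : 1 ≤ k) :
    expLonely n k < expLonely n (k + 1) := by
  obtain ⟨j, rfl⟩ := Nat.exists_eq_add_of_le' hk
  rw [expLonely_succ n j (by omega), expLonely_succ n (j + 1) (by omega)]
  have hn' : (0 : ℝ) < n := by exact_mod_cast (by omega : 0 < n)
  refine mul_lt_mul_of_pos_left (pow_lt_pow_left₀ ?_ (by positivity) (by omega)) hn'
  push_cast
  rw [div_lt_div_iff₀ (by positivity) (by positivity)]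
  nlinarith
end

section
/- Let x' : [n] → [k] be the passenger assignment after reassignment: if the passengers p with x(p) = k+1 are listed in increasing order as p_1 < ⋯ < p_m, set x'(p_j) := Y_j for each j ∈ [m], and x'(p) := x(p) for all other passengers. Then x' is uniformly distributed on the set of all functions [n] → [k]; equivalently, for every f : [n] → [k], the number of configurations (x, y) whose reassigned assignment x' equals f is (k+1)^n. -/
open Finset

/-- A configuration: `x : [n] → [k+1]` assigns passengers to `k + 1` buses and
`y : [n] → [k]` gives the auxiliary reassignment choices `Y_1, …, Y_n`. -/
abbrev Config (n k : ℕ) := (Fin n → Fin (k + 1)) × (Fin n → Fin k)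

/-- `Xcount n k c i` is the number of passengers initially assigned to bus `i`. -/
def Xcount (n k : ℕ) (c : Config n k) (i : Fin (k + 1)) : ℕ :=
  (Finset.univ.filter fun p => c.1 p = i).card

/-- The rank (number of smaller passengers on bus `k+1`) of passenger `p`. -/
def rankOn (n k : ℕ) (c : Config n k) (p : Fin n) : ℕ :=
  (Finset.univ.filter fun q => q < p ∧ c.1 q = Fin.last k).card

lemma rankOn_lt (n k : ℕ) (c : Config n k) (p : Fin n) : rankOn n k c p < n := by
  have h1 : (Finset.univ.filter fun q => q < p ∧ c.1 q = Fin.last k) ⊆ Finset.Iio p := by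
    intro q hq
    simp only [Finset.mem_filter] at hq
    simpa using hq.2.1
  calc rankOn n k c p ≤ (Finset.Iio p).card := Finset.card_le_card h1
    _ = (p : ℕ) := by simp
    _ < n := p.isLt

/-- The assignment after reassignment: if the passengers `p` with
`x p = k + 1` are listed in increasing order as `p_1 < ⋯ < p_m`, then
`x' (p_j) = Y_j`, and `x' p = x p` for all other passengers. -/
def reassign (n k : ℕ) (c : Config n k) : Fin n → Fin k := fun p =>
  if h : c.1 p = Fin.last k then c.2 ⟨rankOn n k c p, rankOn_lt n k c p⟩
  else (c.1 p).castPred h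

/-- Among the passengers on the last bus, `rankOn` is injective. -/
lemma rankOn_injOn (n k : ℕ) (c : Config n k) :
    Set.InjOn (rankOn n k c) {p | c.1 p = Fin.last k} := by
  have key : ∀ p q : Fin n, c.1 p = Fin.last k → p < q → rankOn n k c p < rankOn n k c q := by
    intro p q hp hpq
    refine Finset.card_lt_card ⟨fun r hr => ?_, fun hsub => ?_⟩
    · simp only [Finset.mem_filter, Finset.mem_univ, true_and] at hr ⊢
      exact ⟨hr.1.trans hpq, hr.2⟩
    · have hmem := hsub (Finset.mem_filter.mpr ⟨Finset.mem_univ p, hpq, hp⟩)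
      simp at hmem
  intro p hp q hq h
  rcases lt_trichotomy p q with hlt | heq | hgt
  · exact absurd h (key p q hp hlt).ne
  · exact heq
  · exact absurd h (key q p hq hgt).ne.symm

/-- Translate a configuration by `d`, keeping the set of passengers on the last bus: the other
passengers are moved by `d`, and so are the auxiliary choices used by those on the last bus. -/
def shiftConfig (n k : ℕ) [NeZero k] (d : Fin n → Fin k) (c : Config n k) : Config n k :=
  (fun p => if h : c.1 p = Fin.last k then Fin.last k else ((c.1 p).castPred h + d p).castSucc,
    fun j => c.2 j +
      ∑ p ∈ Finset.univ.filter fun p => c.1 p = Fin.last k ∧ rankOn n k c p = j, d p)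

section Shift

variable {n k : ℕ} [NeZero k] (d : Fin n → Fin k) (c : Config n k)

lemma shiftConfig_fst_eq_last_iff (p : Fin n) :
    (shiftConfig n k d c).1 p = Fin.last k ↔ c.1 p = Fin.last k := by
  by_cases h : c.1 p = Fin.last k <;> simp [shiftConfig, h, Fin.castSucc_ne_last]

lemma rankOn_shiftConfig (p : Fin n) :
    rankOn n k (shiftConfig n k d c) p = rankOn n k c p := by
  simp only [rankOn, shiftConfig_fst_eq_last_iff]

lemma reassign_shiftConfig :
    reassign n k (shiftConfig n k d c) = reassign n k c + d := by
  funext p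
  by_cases h : c.1 p = Fin.last k
  · have h' := (shiftConfig_fst_eq_last_iff d c p).mpr h
    have hfilter : (Finset.univ.filter fun q =>
        c.1 q = Fin.last k ∧ rankOn n k c q = rankOn n k c p) = {p} := by
      ext q
      simp only [Finset.mem_filter, Finset.mem_univ, true_and, Finset.mem_singleton]
      exact ⟨fun hq => rankOn_injOn n k c hq.1 h hq.2, fun hq => by simp [hq, h]⟩
    simp only [reassign, h, h', dif_pos, Pi.add_apply, rankOn_shiftConfig]
    simp only [shiftConfig, hfilter, Finset.sum_singleton]
  · have h' := (shiftConfig_fst_eq_last_iff d c p).not.mpr h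
    simp only [reassign, h, h', dif_neg, not_false_eq_true, Pi.add_apply]
    simp [shiftConfig, h]

lemma shiftConfig_neg_shiftConfig :
    shiftConfig n k (-d) (shiftConfig n k d c) = c := by
  refine Prod.ext (funext fun p => ?_) (funext fun j => ?_)
  · by_cases h : c.1 p = Fin.last k <;> simp [shiftConfig, h, Fin.castSucc_ne_last]
  · change (shiftConfig n k d c).2 j + ∑ p ∈ Finset.univ.filter fun p =>
      (shiftConfig n k d c).1 p = Fin.last k ∧ rankOn n k (shiftConfig n k d c) p = j,
        (-d) p = c.2 j
    simp only [shiftConfig_fst_eq_last_iff, rankOn_shiftConfig]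
    simp [shiftConfig]

end Shift

lemma card_reassign_fiber_le (n k : ℕ) [NeZero k] (f g : Fin n → Fin k) :
    (Finset.univ.filter fun c : Config n k => reassign n k c = f).card ≤
      (Finset.univ.filter fun c : Config n k => reassign n k c = g).card := by
  refine Finset.card_le_card_of_injOn (shiftConfig n k (g - f)) (fun c hc => ?_)
    (Function.LeftInverse.injective (shiftConfig_neg_shiftConfig (g - f))).injOn
  have hc' : reassign n k c = f := by simpa using hc
  simp [reassign_shiftConfig, hc']

lemma card_reassign_fiber (n k : ℕ) [NeZero k] (f : Fin n → Fin k) :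
    (Finset.univ.filter fun c : Config n k => reassign n k c = f).card = (k + 1) ^ n := by
  have hsum := Finset.card_eq_sum_card_fiberwise (s := (Finset.univ : Finset (Config n k)))
    (t := Finset.univ) (f := reassign n k) (fun _ _ => Finset.mem_coe.mpr (Finset.mem_univ _))
  rw [Finset.sum_congr rfl fun g _ =>
    (card_reassign_fiber_le n k g f).antisymm (card_reassign_fiber_le n k f g)] at hsum
  simp only [Finset.card_univ, Fintype.card_prod, Fintype.card_fun, Fintype.card_fin,
    Finset.sum_const, smul_eq_mul] at hsum
  rw [mul_comm] at hsum
  exact (Nat.eq_of_mul_eq_mul_left (pow_pos (NeZero.pos k) n) hsum).symm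

/-- The reassigned allocation is uniformly distributed on `[n] → [k]`: for each
function `f : [n] → [k]` there are exactly `(k+1)^n` configurations whose
reassigned assignment equals `f`; equivalently, each `f` occurs with
probability `1 / k^n`. -/
theorem reassign_uniform (n k : ℕ) (hn : 2 ≤ n) (hk : 1 ≤ k) :
    ∀ f : Fin n → Fin k,
      ((Finset.univ.filter fun c : Config n k => reassign n k c = f).card = (k + 1) ^ n ∧
        ((Finset.univ.filter fun c : Config n k => reassign n k c = f).card : ℝ) /
            (Fintype.card (Config n k) : ℝ) = 1 / (k : ℝ) ^ n) := by
  intro f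
  have : NeZero k := ⟨by omega⟩
  refine ⟨card_reassign_fiber n k f, ?_⟩
  have hk0 : (k : ℝ) ≠ 0 := Nat.cast_ne_zero.mpr (NeZero.ne k)
  have hk1 : (k : ℝ) + 1 ≠ 0 := by positivity
  rw [card_reassign_fiber]
  simp only [Fintype.card_prod, Fintype.card_fun, Fintype.card_fin]
  push_cast
  field_simp
end

section
/- The events B_2, …, B_n are pairwise disjoint, each B_m is contained in A ∩ (A')ᶜ, and consequently P(A ∩ (A')ᶜ) ≥ Σ_{m=2}^n P(B_m). -/
open Finset

/-- `Xcount' n k c i` is the number of passengers on bus `i ∈ [k]` after the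
`m = X_{k+1}` passengers on bus `k + 1` are reassigned to buses `Y_1, …, Y_m`. -/
def Xcount' (n k : ℕ) (c : Config n k) (i : Fin k) : ℕ :=
  Xcount n k c i.castSucc +
    (Finset.univ.filter fun j : Fin n =>
      (j : ℕ) < Xcount n k c (Fin.last k) ∧ c.2 j = i).card

open Classical in
/-- The probability of an event under the uniform distribution on
configurations. -/
noncomputable def prob (n k : ℕ) (E : Set (Config n k)) : ℝ :=
  ((Finset.univ.filter fun c => c ∈ E).card : ℝ) / (Fintype.card (Config n k) : ℝ)

/-- The event `A` that some bus (among all `k + 1`) has exactly one passenger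
before reassignment. -/
def eventA (n k : ℕ) : Set (Config n k) := {c | ∃ i : Fin (k + 1), Xcount n k c i = 1}

/-- The event `A'` that some bus among the first `k` has exactly one passenger
after reassignment. -/
def eventA' (n k : ℕ) : Set (Config n k) := {c | ∃ i : Fin k, Xcount' n k c i = 1}

/-- The event `B_m`: bus `k + 1` has exactly one passenger, bus `Y_1` has
`m - 1` passengers, and no bus other than `Y_1` and `k + 1` has exactly one
passenger. -/
def eventB (n k : ℕ) (hn : 0 < n) (m : ℕ) : Set (Config n k) :=
  {c | Xcount n k c (Fin.last k) = 1 ∧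
       Xcount n k c ((c.2 ⟨0, hn⟩).castSucc) = m - 1 ∧
       ∀ i : Fin (k + 1), i ≠ (c.2 ⟨0, hn⟩).castSucc → i ≠ Fin.last k →
         Xcount n k c i ≠ 1}

/-- If bus `k + 1` has exactly one passenger, only the bus `Y_1` gains a passenger. -/
theorem Xcount'_of_last_eq_one {n k : ℕ} (hn : 0 < n) {c : Config n k}
    (hc : Xcount n k c (Fin.last k) = 1) (i : Fin k) :
    Xcount' n k c i = Xcount n k c i.castSucc + if c.2 ⟨0, hn⟩ = i then 1 else 0 := by
  have hfilter : (Finset.univ.filter fun j : Fin n => (j : ℕ) < 1 ∧ c.2 j = i) =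
      if c.2 ⟨0, hn⟩ = i then {⟨0, hn⟩} else ∅ := by
    ext j
    have hj : (j : ℕ) < 1 ↔ j = ⟨0, hn⟩ := by simp [Fin.ext_iff]
    split_ifs with h
    · simp only [hj, mem_filter, mem_univ, true_and, mem_singleton, and_iff_left_iff_imp]
      rintro rfl
      exact h
    · simp only [hj, mem_filter, mem_univ, true_and, notMem_empty, iff_false]
      rintro ⟨rfl, hji⟩
      exact h hji
  rw [Xcount', hc, hfilter]
  split_ifs <;> simp

theorem eventB_subset {n k m : ℕ} (hn : 0 < n) (hm : 2 ≤ m) :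
    eventB n k hn m ⊆ eventA n k ∩ (eventA' n k)ᶜ := by
  rintro c ⟨hlast, hY, hother⟩
  refine ⟨⟨_, hlast⟩, ?_⟩
  rintro ⟨i, hi⟩
  rw [Xcount'_of_last_eq_one hn hlast] at hi
  split_ifs at hi with h
  · subst h
    omega
  · exact hother i.castSucc (fun he => h (Fin.castSucc_injective k he).symm)
      (Fin.castSucc_lt_last i).ne hi

theorem disjoint_eventB {n k m m' : ℕ} (hn : 0 < n) (hm : 1 ≤ m) (hm' : 1 ≤ m')
    (hne : m ≠ m') : Disjoint (eventB n k hn m) (eventB n k hn m') := by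
  rw [Set.disjoint_left]
  rintro c ⟨-, h, -⟩ ⟨-, h', -⟩
  omega

/-- Pairwise disjoint events contained in `F` have total probability at most that of `F`. -/
theorem sum_prob_le_prob {n k : ℕ} {ι : Type*} (s : Finset ι) (E : ι → Set (Config n k))
    (F : Set (Config n k)) (hdisj : ∀ a ∈ s, ∀ b ∈ s, a ≠ b → Disjoint (E a) (E b))
    (hsub : ∀ a ∈ s, E a ⊆ F) : ∑ a ∈ s, prob n k (E a) ≤ prob n k F := by
  classical
  simp only [prob]
  rw [← Finset.sum_div]
  gcongr
  rw [← Nat.cast_sum, ← Finset.card_biUnion]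
  · gcongr
    intro c hc
    simp only [mem_biUnion, mem_filter, mem_univ, true_and] at hc ⊢
    obtain ⟨a, ha, hca⟩ := hc
    exact hsub a ha hca
  · intro a ha b hb hab
    rw [Function.onFun, Finset.disjoint_left]
    intro c hca hcb
    simp only [mem_filter, mem_univ, true_and] at hca hcb
    exact Set.disjoint_left.mp (hdisj a ha b hb hab) hca hcb

/-- The events `B_2, …, B_n` are pairwise disjoint, each `B_m` is contained in
`A ∩ (A')ᶜ`, and consequently `P(A ∩ (A')ᶜ) ≥ ∑_{m=2}^n P(B_m)`. -/
theorem eventB_disjoint_subset_sum (n k : ℕ) (hn : 2 ≤ n) (hk : 1 ≤ k) :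
    (∀ m ∈ Finset.Icc 2 n, ∀ m' ∈ Finset.Icc 2 n, m ≠ m' →
        Disjoint (eventB n k (by omega) m) (eventB n k (by omega) m')) ∧
      (∀ m ∈ Finset.Icc 2 n, eventB n k (by omega) m ⊆ eventA n k ∩ (eventA' n k)ᶜ) ∧
      ∑ m ∈ Finset.Icc 2 n, prob n k (eventB n k (by omega) m) ≤
        prob n k (eventA n k ∩ (eventA' n k)ᶜ) := by
  have hdisj : ∀ m ∈ Finset.Icc 2 n, ∀ m' ∈ Finset.Icc 2 n, m ≠ m' →
      Disjoint (eventB n k (by omega) m) (eventB n k (by omega) m') := by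
    intro m hm m' hm' hne
    rw [Finset.mem_Icc] at hm hm'
    exact disjoint_eventB _ (by omega) (by omega) hne
  have hsub : ∀ m ∈ Finset.Icc 2 n,
      eventB n k (by omega) m ⊆ eventA n k ∩ (eventA' n k)ᶜ :=
    fun m hm => eventB_subset _ (Finset.mem_Icc.mp hm).1
  exact ⟨hdisj, hsub, sum_prob_le_prob _ _ _ hdisj hsub⟩
end

section
/- One has the strict inequality P(A' ∩ Aᶜ) < Σ_{m=2}^n P(B'_m). (Indeed A' ∩ Aᶜ ∩ {X_{k+1} = m} ⊆ B'_m for every 2 ≤ m ≤ n, A' ∩ Aᶜ ∩ {X_{k+1} ≤ 1} = ∅, and the inclusion is strict for m = n.) -/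
open Finset

/-- The event `B'_m`: bus `k + 1` has exactly `m` passengers, no bus `i ∈ [k]`
has exactly one passenger, and `X_{Y_j} = 0` for at least one `j ∈ [m]`. -/
def eventB' (n k m : ℕ) : Set (Config n k) :=
  {c | Xcount n k c (Fin.last k) = m ∧
       (∀ i : Fin k, Xcount n k c i.castSucc ≠ 1) ∧
       ∃ j : Fin n, (j : ℕ) < m ∧ Xcount n k c ((c.2 j).castSucc) = 0}

/-- If no bus starts with one passenger but one of the first `k` ends up with one, then at
least two passengers were reassigned, and one of them went to an empty bus. -/
lemma exists_mem_eventB'_of_mem {n k : ℕ} {c : Config n k}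
    (hc : c ∈ eventA' n k ∩ (eventA n k)ᶜ) :
    ∃ m ∈ Finset.Icc 2 n, c ∈ eventB' n k m := by
  obtain ⟨⟨i, hi⟩, hA⟩ := hc
  have hne : ∀ l, Xcount n k c l ≠ 1 := fun l hl => hA ⟨l, hl⟩
  have hle : Xcount n k c (Fin.last k) ≤ n := by
    simpa [Xcount] using Finset.card_filter_le Finset.univ fun p => c.1 p = Fin.last k
  unfold Xcount' at hi
  have hi0 : Xcount n k c i.castSucc = 0 := by
    have := hne i.castSucc
    omega
  rw [hi0, zero_add] at hi
  obtain ⟨j, hj⟩ := Finset.card_pos.mp (hi ▸ Nat.one_pos)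
  obtain ⟨hjm, rfl⟩ := (Finset.mem_filter.mp hj).2
  have hm := hne (Fin.last k)
  exact ⟨_, Finset.mem_Icc.mpr ⟨by omega, hle⟩, rfl, fun i => hne i.castSucc, j, hjm, hi0⟩

lemma Xcount_const_last_castSucc {n k : ℕ} (y : Fin n → Fin k) (i : Fin k) :
    Xcount n k (fun _ => Fin.last k, y) i.castSucc = 0 := by
  simp [Xcount, (Fin.castSucc_ne_last i).symm]

lemma Xcount_const_last_last {n k : ℕ} (y : Fin n → Fin k) :
    Xcount n k (fun _ => Fin.last k, y) (Fin.last k) = n := by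
  simp [Xcount]

/-- Putting everyone on bus `k + 1` and reassigning everyone to the same bus gives an element
of `B'_n`. -/
lemma const_mem_eventB' {n k : ℕ} (hn : 0 < n) (i : Fin k) :
    ((fun _ => Fin.last k, fun _ => i) : Config n k) ∈ eventB' n k n :=
  ⟨Xcount_const_last_last _, fun l => by simp [Xcount_const_last_castSucc],
    ⟨0, hn⟩, hn, Xcount_const_last_castSucc _ _⟩

lemma const_notMem_eventA' {n k : ℕ} (hn : n ≠ 1) (i : Fin k) :
    ((fun _ => Fin.last k, fun _ => i) : Config n k) ∉ eventA' n k := by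
  rintro ⟨l, hl⟩
  rw [Xcount', Xcount_const_last_castSucc, Xcount_const_last_last] at hl
  by_cases h : i = l <;> simp [h] at hl
  exact hn hl

lemma pairwiseDisjoint_eventB' (n k : ℕ) : Pairwise (Function.onFun Disjoint (eventB' n k)) :=
  fun _ _ h => Set.disjoint_left.mpr fun _ h₁ h₂ => h (h₁.1.symm.trans h₂.1)

/-- The strict inequality `P(A' ∩ Aᶜ) < ∑_{m=2}^n P(B'_m)`. -/
theorem prob_lt_sum_eventB' (n k : ℕ) (hn : 2 ≤ n) (hk : 1 ≤ k) :
    prob n k (eventA' n k ∩ (eventA n k)ᶜ) <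
      ∑ m ∈ Finset.Icc 2 n, prob n k (eventB' n k m) := by
  classical
  let i : Fin k := ⟨0, hk⟩
  have : Nonempty (Config n k) := ⟨(fun _ => Fin.last k, fun _ => i)⟩
  unfold prob
  rw [← Finset.sum_div, ← Nat.cast_sum, ← Finset.card_biUnion]
  · refine div_lt_div_of_pos_right ?_ (Nat.cast_pos.mpr Fintype.card_pos)
    refine Nat.cast_lt.mpr (Finset.card_lt_card ((Finset.ssubset_iff_of_subset ?_).mpr ?_))
    · intro c hc
      simp only [Finset.mem_filter, Finset.mem_univ, true_and] at hc
      obtain ⟨m, hm, hcm⟩ := exists_mem_eventB'_of_mem hc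
      exact Finset.mem_biUnion.mpr ⟨m, hm, Finset.mem_filter.mpr ⟨Finset.mem_univ _, hcm⟩⟩
    · refine ⟨(fun _ => Fin.last k, fun _ => i), Finset.mem_biUnion.mpr ⟨n, ?_, ?_⟩, fun h => ?_⟩
      · exact Finset.mem_Icc.mpr ⟨hn, le_rfl⟩
      · exact Finset.mem_filter.mpr ⟨Finset.mem_univ _, const_mem_eventB' (by omega) i⟩
      · simp only [Finset.mem_filter, Finset.mem_univ, true_and] at h
        exact const_notMem_eventA' (by omega) i h.1
  · intro a _ b _ hab
    exact Finset.disjoint_filter.mpr fun c _ ha hb =>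
      Set.disjoint_left.mp (pairwiseDisjoint_eventB' n k hab) ha hb
end

section
/- For every 2 ≤ m ≤ n, P(B_m) = m · P(C_{m,1}). (There is a bijection between configurations in B_m and pairs (σ, i), where σ is a configuration in C_{m,1} and i is one of the m passengers assigned to bus k+1 in σ: in one direction move all passengers from bus Y_1 to bus k+1; in the other, move all but passenger i from bus k+1 to bus Y_1.) -/
open Finset

/-- The event `C_{m,1} = B'_m ∩ {X_{Y_1} = 0}`. -/
def eventC (n k : ℕ) (hn : 0 < n) (m : ℕ) : Set (Config n k) :=
  eventB' n k m ∩ {c | Xcount n k c ((c.2 ⟨0, hn⟩).castSucc) = 0}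

/-- Exchange the passengers of bus `k + 1` and bus `b`, except that passenger `p` stays put. -/
def exchangeExcept {n k : ℕ} (b : Fin k) (p : Fin n) (c : Config n k) : Config n k :=
  (fun q => if q = p then c.1 q else Equiv.swap (Fin.last k) b.castSucc (c.1 q), c.2)

theorem exchangeExcept_exchangeExcept {n k : ℕ} (b : Fin k) (p : Fin n) (c : Config n k) :
    exchangeExcept b p (exchangeExcept b p c) = c := by
  refine Prod.ext (funext fun q => ?_) rfl
  by_cases h : q = p <;> simp [exchangeExcept, h]

theorem exchangeExcept_fst_self {n k : ℕ} (b : Fin k) (p : Fin n) (c : Config n k) :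
    (exchangeExcept b p c).1 p = c.1 p := by
  simp [exchangeExcept]

theorem Xcount_exchangeExcept_last {n k : ℕ} (b : Fin k) {p : Fin n} {c : Config n k}
    (hp : c.1 p = Fin.last k) :
    Xcount n k (exchangeExcept b p c) (Fin.last k) = Xcount n k c b.castSucc + 1 := by
  have hb := Fin.castSucc_ne_last b
  unfold Xcount
  rw [← Finset.card_insert_of_notMem (a := p) (by simp [hp, hb.symm])]
  congr 1
  ext q
  simp only [Finset.mem_filter, Finset.mem_univ, true_and, Finset.mem_insert]
  by_cases h : q = p
  · simp [exchangeExcept, h, hp]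
  · simp [exchangeExcept, h, Equiv.swap_apply_eq_iff]

theorem Xcount_exchangeExcept_castSucc {n k : ℕ} (b : Fin k) {p : Fin n} {c : Config n k}
    (hp : c.1 p = Fin.last k) :
    Xcount n k (exchangeExcept b p c) b.castSucc + 1 = Xcount n k c (Fin.last k) := by
  rw [← Xcount_exchangeExcept_last b ((exchangeExcept_fst_self b p c).trans hp),
    exchangeExcept_exchangeExcept]

theorem Xcount_exchangeExcept_of_ne {n k : ℕ} {b : Fin k} {p : Fin n} {c : Config n k}
    {i : Fin (k + 1)} (hib : i ≠ b.castSucc) (hil : i ≠ Fin.last k) :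
    Xcount n k (exchangeExcept b p c) i = Xcount n k c i := by
  unfold Xcount
  congr 1
  ext q
  simp only [Finset.mem_filter, Finset.mem_univ, true_and]
  by_cases h : q = p
  · simp [exchangeExcept, h]
  · simp [exchangeExcept, h, Equiv.swap_apply_eq_iff, Equiv.swap_apply_of_ne_of_ne hil hib]

theorem mem_eventC_iff {n k : ℕ} (hn : 0 < n) {m : ℕ} (hm : 0 < m) (c : Config n k) :
    c ∈ eventC n k hn m ↔ Xcount n k c (Fin.last k) = m ∧
      Xcount n k c (c.2 ⟨0, hn⟩).castSucc = 0 ∧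
      ∀ i : Fin (k + 1), i ≠ (c.2 ⟨0, hn⟩).castSucc → i ≠ Fin.last k → Xcount n k c i ≠ 1 := by
  constructor
  · rintro ⟨⟨h1, h2, -⟩, h3⟩
    refine ⟨h1, h3, fun i _ hl => ?_⟩
    obtain ⟨j, rfl⟩ := Fin.exists_castSucc_eq.2 hl
    exact h2 j
  · rintro ⟨h1, h2, h3⟩
    refine ⟨⟨h1, fun i => ?_, ⟨0, hn⟩, hm, h2⟩, h2⟩
    by_cases hi : i = c.2 ⟨0, hn⟩
    · rw [hi, h2]
      exact zero_ne_one
    · exact h3 _ (fun h => hi (Fin.castSucc_injective k h)) (Fin.castSucc_ne_last i)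

theorem exchangeExcept_mem_eventC {n k : ℕ} (hn : 0 < n) {m : ℕ} (hm : 0 < m) {p : Fin n}
    {c : Config n k} (hp : c.1 p = Fin.last k) (hc : c ∈ eventB n k hn m) :
    exchangeExcept (c.2 ⟨0, hn⟩) p c ∈ eventC n k hn m := by
  obtain ⟨h1, h2, h3⟩ := hc
  have hl := Xcount_exchangeExcept_last (c.2 ⟨0, hn⟩) hp
  have hb := Xcount_exchangeExcept_castSucc (c.2 ⟨0, hn⟩) hp
  refine (mem_eventC_iff hn hm _).2 ⟨by omega, ?_, fun i hib hil => ?_⟩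
  · change Xcount n k _ (c.2 ⟨0, hn⟩).castSucc = 0
    omega
  · exact (Xcount_exchangeExcept_of_ne hib hil).trans_ne (h3 i hib hil)

theorem exchangeExcept_mem_eventB {n k : ℕ} (hn : 0 < n) {m : ℕ} (hm : 0 < m) {p : Fin n}
    {c : Config n k} (hp : c.1 p = Fin.last k) (hc : c ∈ eventC n k hn m) :
    exchangeExcept (c.2 ⟨0, hn⟩) p c ∈ eventB n k hn m := by
  obtain ⟨h1, h2, h3⟩ := (mem_eventC_iff hn hm c).1 hc
  have hl := Xcount_exchangeExcept_last (c.2 ⟨0, hn⟩) hp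
  have hb := Xcount_exchangeExcept_castSucc (c.2 ⟨0, hn⟩) hp
  refine ⟨by omega, ?_, fun i hib hil => ?_⟩
  · change Xcount n k _ (c.2 ⟨0, hn⟩).castSucc = m - 1
    omega
  · exact (Xcount_exchangeExcept_of_ne hib hil).trans_ne (h3 i hib hil)

theorem card_sigma_last {n k a : ℕ} {s : Finset (Config n k)}
    (hs : ∀ c ∈ s, Xcount n k c (Fin.last k) = a) :
    (s.sigma fun c => Finset.univ.filter fun p : Fin n => c.1 p = Fin.last k).card =
      a * s.card := by
  rw [Finset.card_sigma, mul_comm]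
  exact Finset.sum_const_nat hs

open Classical in
theorem card_eventB_eq {n k : ℕ} (hn : 0 < n) {m : ℕ} (hm : 0 < m) :
    (Finset.univ.filter fun c => c ∈ eventB n k hn m).card =
      m * (Finset.univ.filter fun c => c ∈ eventC n k hn m).card := by
  rw [← one_mul (Finset.card _),
    ← card_sigma_last (a := 1) (fun c hc => (Finset.mem_filter.1 hc).2.1),
    ← card_sigma_last (a := m) (fun c hc => (Finset.mem_filter.1 hc).2.1.1)]
  refine Finset.card_nbij' (fun x => ⟨exchangeExcept (x.1.2 ⟨0, hn⟩) x.2 x.1, x.2⟩)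
    (fun x => ⟨exchangeExcept (x.1.2 ⟨0, hn⟩) x.2 x.1, x.2⟩) ?_ ?_ ?_ ?_
  · rintro ⟨c, p⟩ h
    simp only [Finset.coe_sigma, Set.mem_sigma_iff, Finset.mem_coe, Finset.mem_filter,
      Finset.mem_univ, true_and] at h ⊢
    exact ⟨exchangeExcept_mem_eventC hn hm h.2 h.1, (exchangeExcept_fst_self _ _ _).trans h.2⟩
  · rintro ⟨c, p⟩ h
    simp only [Finset.coe_sigma, Set.mem_sigma_iff, Finset.mem_coe, Finset.mem_filter,
      Finset.mem_univ, true_and] at h ⊢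
    exact ⟨exchangeExcept_mem_eventB hn hm h.2 h.1, (exchangeExcept_fst_self _ _ _).trans h.2⟩
  all_goals
    rintro ⟨c, p⟩ -
    exact congrArg (Sigma.mk · p) (exchangeExcept_exchangeExcept (c.2 ⟨0, hn⟩) p c)

/-- For every `2 ≤ m ≤ n`, `P(B_m) = m · P(C_{m,1})`. -/
theorem prob_eventB_eq (n k : ℕ) (hn : 2 ≤ n) (hk : 1 ≤ k) (m : ℕ)
    (hm2 : 2 ≤ m) (hmn : m ≤ n) :
    prob n k (eventB n k (by omega) m) = m * prob n k (eventC n k (by omega) m) := by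
  unfold prob
  rw [card_eventB_eq (by omega) (by omega), Nat.cast_mul, mul_div_assoc]
end

section
/- One has the strict inequality P(A ∩ (A')ᶜ) > P(A' ∩ Aᶜ). -/
open Finset

open scoped Nat PowerSeries

/-- The Binet–Cauchy identity, summed over all ordered pairs of indices. -/
theorem sum_mul_sum_sub_eq {ι : Type*} (s : Finset ι) (a b x y : ι → ℝ) :
    2 * ((∑ p ∈ s, a p * x p) * (∑ p ∈ s, b p * y p) -
        (∑ p ∈ s, a p * y p) * (∑ p ∈ s, b p * x p)) =
      ∑ p ∈ s, ∑ q ∈ s, (a p * b q - a q * b p) * (x p * y q - x q * y p) := by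
  have h : ∀ p q, (a p * b q - a q * b p) * (x p * y q - x q * y p) =
      (a p * x p) * (b q * y q) - (a p * y p) * (b q * x q)
        - (b p * x p) * (a q * y q) + (b p * y p) * (a q * x q) := fun p q => by ring
  simp only [h, sum_add_distrib, sum_sub_distrib, ← sum_mul_sum]
  ring

theorem cross_mul_nonneg {a b x y : ℕ → ℝ} {N : ℕ}
    (hab : ∀ p q, p ≤ q → q < N → a q * b p ≤ a p * b q)
    (hxy : ∀ p q, p ≤ q → q < N → x q * y p ≤ x p * y q) {p q : ℕ} (hp : p < N) (hq : q < N) :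
    0 ≤ (a p * b q - a q * b p) * (x p * y q - x q * y p) := by
  rcases le_total p q with h | h
  · exact mul_nonneg (sub_nonneg.2 (hab p q h hq)) (sub_nonneg.2 (hxy p q h hq))
  · exact mul_nonneg_of_nonpos_of_nonpos (sub_nonpos.2 (hab q p h hp)) (sub_nonpos.2 (hxy q p h hp))

theorem sum_mul_sum_le_of_cross {a b x y : ℕ → ℝ} {N : ℕ}
    (hab : ∀ p q, p ≤ q → q < N → a q * b p ≤ a p * b q)
    (hxy : ∀ p q, p ≤ q → q < N → x q * y p ≤ x p * y q) :
    (∑ p ∈ range N, a p * y p) * (∑ p ∈ range N, b p * x p) ≤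
      (∑ p ∈ range N, a p * x p) * (∑ p ∈ range N, b p * y p) := by
  have h := sum_mul_sum_sub_eq (range N) a b x y
  have : 0 ≤ ∑ p ∈ range N, ∑ q ∈ range N, (a p * b q - a q * b p) * (x p * y q - x q * y p) :=
    sum_nonneg fun p hp => sum_nonneg fun q hq =>
      cross_mul_nonneg hab hxy (mem_range.1 hp) (mem_range.1 hq)
  linarith

theorem sum_mul_sum_lt_of_cross {a b x y : ℕ → ℝ} {N : ℕ}
    (hab : ∀ p q, p ≤ q → q < N → a q * b p ≤ a p * b q)
    (hxy : ∀ p q, p ≤ q → q < N → x q * y p ≤ x p * y q)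
    {p q : ℕ} (hp : p < N) (hq : q < N)
    (hab' : a q * b p < a p * b q) (hxy' : x q * y p < x p * y q) :
    (∑ p ∈ range N, a p * y p) * (∑ p ∈ range N, b p * x p) <
      (∑ p ∈ range N, a p * x p) * (∑ p ∈ range N, b p * y p) := by
  have h := sum_mul_sum_sub_eq (range N) a b x y
  have : 0 < ∑ p ∈ range N, ∑ q ∈ range N, (a p * b q - a q * b p) * (x p * y q - x q * y p) := by
    have hnn : ∀ p ∈ range N, ∀ q ∈ range N,
        0 ≤ (a p * b q - a q * b p) * (x p * y q - x q * y p) := fun p hp q hq =>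
      cross_mul_nonneg hab hxy (mem_range.1 hp) (mem_range.1 hq)
    refine sum_pos' (fun p hp => sum_nonneg (hnn p hp)) ⟨p, mem_range.2 hp, ?_⟩
    exact sum_pos' (hnn p (mem_range.2 hp)) ⟨q, mem_range.2 hq,
      mul_pos (sub_pos.2 hab') (sub_pos.2 hxy')⟩
  linarith

/-- The likelihood ratio order on power series: `coeff n b / coeff n a` is nondecreasing in `n`. -/
def LikelihoodRatioLE (a b : ℝ⟦X⟧) : Prop :=
  ∀ i j, i ≤ j → a.coeff j * b.coeff i ≤ a.coeff i * b.coeff j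

/-- Log-concavity of the coefficients, without internal zeros. -/
def LogConcaveCoeff (h : ℝ⟦X⟧) : Prop :=
  ∀ u d e, h.coeff u * h.coeff (u + d + e) ≤ h.coeff (u + d) * h.coeff (u + e)

theorem coeff_mul_eq_sum_range {a h : ℝ⟦X⟧} {i N : ℕ} (hi : i < N) :
    (a * h).coeff i = ∑ p ∈ range N, a.coeff p * (if p ≤ i then h.coeff (i - p) else 0) := by
  rw [PowerSeries.coeff_mul, Nat.sum_antidiagonal_eq_sum_range_succ_mk]
  simp only [mul_ite, mul_zero]
  rw [← sum_filter]
  congr 1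
  ext p
  simp only [mem_range, mem_filter]
  omega

theorem LikelihoodRatioLE.mul_right {a b h : ℝ⟦X⟧} (hab : LikelihoodRatioLE a b)
    (hh : LogConcaveCoeff h) (h0 : ∀ n, 0 ≤ h.coeff n) : LikelihoodRatioLE (a * h) (b * h) := by
  intro i j hij
  rw [coeff_mul_eq_sum_range (a := a) (h := h) (Nat.lt_succ_self j),
    coeff_mul_eq_sum_range (a := b) (h := h) (Nat.lt_succ_self j),
    coeff_mul_eq_sum_range (a := a) (h := h) (Nat.lt_succ_of_le hij),
    coeff_mul_eq_sum_range (a := b) (h := h) (Nat.lt_succ_of_le hij)]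
  refine sum_mul_sum_le_of_cross (fun p q hpq _ => hab p q hpq) fun p q hpq hq => ?_
  have hqj : q ≤ j := Nat.lt_succ_iff.1 hq
  rw [if_pos hqj, if_pos (hpq.trans hqj)]
  split_ifs with hqi hpi hpi
  · have := hh (i - q) (q - p) (j - i)
    rwa [show i - q + (q - p) + (j - i) = j - p by omega, show i - q + (q - p) = i - p by omega,
      show i - q + (j - i) = j - q by omega] at this
  · omega
  · rw [zero_mul]
    exact mul_nonneg (h0 _) (h0 _)
  · simp

theorem LikelihoodRatioLE.trans {a b c : ℝ⟦X⟧} (hab : LikelihoodRatioLE a b)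
    (hbc : LikelihoodRatioLE b c) (ha : ∀ n, 0 ≤ a.coeff n) (hc : ∀ n, 0 ≤ c.coeff n)
    (hcb : ∀ n, c.coeff n ≤ b.coeff n) : LikelihoodRatioLE a c := by
  intro i j hij
  have hb : ∀ n, 0 ≤ b.coeff n := fun n => (hc n).trans (hcb n)
  have h1 := hab i j hij
  have h2 := hbc i j hij
  rcases (hb i).eq_or_lt with hi | hi
  · have : c.coeff i = 0 := le_antisymm (hi ▸ hcb i) (hc i)
    rw [this, mul_zero]
    exact mul_nonneg (ha i) (hc j)
  rcases (hb j).eq_or_lt with hj | hj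
  · rw [← hj, mul_zero] at h1
    have : a.coeff j = 0 := le_antisymm (nonpos_of_mul_nonpos_left h1 hi) (ha j)
    rw [this, zero_mul]
    exact mul_nonneg (ha i) (hc j)
  · refine le_of_mul_le_mul_right ?_ (mul_pos hi hj)
    calc a.coeff j * c.coeff i * (b.coeff i * b.coeff j)
        = (a.coeff j * b.coeff i) * (b.coeff j * c.coeff i) := by ring
      _ ≤ (a.coeff i * b.coeff j) * (b.coeff i * c.coeff j) :=
        mul_le_mul h1 h2 (mul_nonneg (hb j) (hc i)) (mul_nonneg (ha i) (hb j))
      _ = a.coeff i * c.coeff j * (b.coeff i * b.coeff j) := by ring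

theorem coeff_mul_nonneg {a b : ℝ⟦X⟧} (ha : ∀ n, 0 ≤ a.coeff n) (hb : ∀ n, 0 ≤ b.coeff n) (n : ℕ) :
    0 ≤ (a * b).coeff n := by
  rw [PowerSeries.coeff_mul]
  exact sum_nonneg fun p _ => mul_nonneg (ha _) (hb _)

theorem coeff_pow_nonneg {a : ℝ⟦X⟧} (ha : ∀ n, 0 ≤ a.coeff n) (r n : ℕ) :
    0 ≤ (a ^ r).coeff n := by
  induction r generalizing n with
  | zero => rw [pow_zero, PowerSeries.coeff_one]; split_ifs <;> norm_num
  | succ r ih => rw [pow_succ]; exact coeff_mul_nonneg ih ha n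

theorem coeff_mul_le_coeff_mul {a b c d : ℝ⟦X⟧} (hab : ∀ n, a.coeff n ≤ b.coeff n)
    (hcd : ∀ n, c.coeff n ≤ d.coeff n) (hb : ∀ n, 0 ≤ b.coeff n) (hc : ∀ n, 0 ≤ c.coeff n)
    (n : ℕ) : (a * c).coeff n ≤ (b * d).coeff n := by
  simp only [PowerSeries.coeff_mul]
  exact sum_le_sum fun p _ => mul_le_mul (hab _) (hcd _) (hc _) (hb _)

theorem coeff_pow_le_coeff_pow {a b : ℝ⟦X⟧} (ha : ∀ n, 0 ≤ a.coeff n)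
    (hab : ∀ n, a.coeff n ≤ b.coeff n) (r n : ℕ) : (a ^ r).coeff n ≤ (b ^ r).coeff n := by
  have hb : ∀ n, 0 ≤ b.coeff n := fun n => (ha n).trans (hab n)
  induction r generalizing n with
  | zero => simp
  | succ r ih =>
    rw [pow_succ, pow_succ]
    exact coeff_mul_le_coeff_mul ih hab (coeff_pow_nonneg hb r) ha n

theorem LikelihoodRatioLE.mul_pow_right {a b h : ℝ⟦X⟧} (hab : LikelihoodRatioLE a b)
    (hh : LogConcaveCoeff h) (h0 : ∀ n, 0 ≤ h.coeff n) (r : ℕ) :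
    LikelihoodRatioLE (a * h ^ r) (b * h ^ r) := by
  induction r with
  | zero => simpa using hab
  | succ r ih =>
    rw [pow_succ, ← mul_assoc, ← mul_assoc]
    exact ih.mul_right hh h0

theorem LikelihoodRatioLE.pow {f g : ℝ⟦X⟧} (hfg : LikelihoodRatioLE f g)
    (hf : LogConcaveCoeff f) (hg : LogConcaveCoeff g) (g0 : ∀ n, 0 ≤ g.coeff n)
    (hgf : ∀ n, g.coeff n ≤ f.coeff n) (r : ℕ) : LikelihoodRatioLE (f ^ r) (g ^ r) := by
  have f0 : ∀ n, 0 ≤ f.coeff n := fun n => (g0 n).trans (hgf n)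
  induction r with
  | zero => intro i j _; simp [mul_comm]
  | succ r ih =>
    have h1 : LikelihoodRatioLE (f ^ (r + 1)) (f * g ^ r) := by
      rw [pow_succ, mul_comm f (g ^ r)]
      exact ih.mul_right hf f0
    have h2 : LikelihoodRatioLE (f * g ^ r) (g ^ (r + 1)) := by
      rw [pow_succ']
      exact hfg.mul_pow_right hg g0 r
    refine h1.trans h2 (coeff_pow_nonneg f0 _) (coeff_pow_nonneg g0 _) fun n => ?_
    rw [pow_succ']
    exact coeff_mul_le_coeff_mul hgf (fun _ => le_rfl) f0 (coeff_pow_nonneg g0 r) n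

theorem LikelihoodRatioLE.coeff_pow_mul_coeff_pow_le {f g : ℝ⟦X⟧} (hfg : LikelihoodRatioLE f g)
    (hf : LogConcaveCoeff f) (hg : LogConcaveCoeff g) (g0 : ∀ n, 0 ≤ g.coeff n)
    (hgf : ∀ n, g.coeff n ≤ f.coeff n) {s r : ℕ} (hsr : s ≤ r) (n : ℕ) :
    (g ^ r).coeff n * (f ^ s).coeff n ≤ (g ^ s).coeff n * (f ^ r).coeff n := by
  have f0 : ∀ n, 0 ≤ f.coeff n := fun n => (g0 n).trans (hgf n)
  obtain ⟨d, rfl⟩ := Nat.exists_eq_add_of_le hsr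
  rw [pow_add, pow_add, PowerSeries.coeff_mul, PowerSeries.coeff_mul, sum_mul, mul_sum]
  refine sum_le_sum fun p hp => ?_
  have h1 := hfg.pow hf hg g0 hgf s p.1 n (Nat.le.intro (HasAntidiagonal.mem_antidiagonal.1 hp))
  have h2 := coeff_pow_le_coeff_pow g0 hgf d p.2
  calc (g ^ s).coeff p.1 * (g ^ d).coeff p.2 * (f ^ s).coeff n
      = ((f ^ s).coeff n * (g ^ s).coeff p.1) * (g ^ d).coeff p.2 := by ring
    _ ≤ ((f ^ s).coeff p.1 * (g ^ s).coeff n) * (f ^ d).coeff p.2 :=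
      mul_le_mul h1 h2 (coeff_pow_nonneg g0 _ _)
        (mul_nonneg (coeff_pow_nonneg f0 _ _) (coeff_pow_nonneg g0 _ _))
    _ = (g ^ s).coeff n * ((f ^ s).coeff p.1 * (f ^ d).coeff p.2) := by ring

/-- The exponential generating function of the set of sizes satisfying `P`. -/
noncomputable def sizeEGF (P : ℕ → Prop) [DecidablePred P] : ℝ⟦X⟧ :=
  PowerSeries.mk fun m => if P m then (m ! : ℝ)⁻¹ else 0

theorem coeff_sizeEGF (P : ℕ → Prop) [DecidablePred P] (m : ℕ) :
    (sizeEGF P).coeff m = if P m then (m ! : ℝ)⁻¹ else 0 :=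
  PowerSeries.coeff_mk _ _

theorem coeff_sizeEGF_nonneg (P : ℕ → Prop) [DecidablePred P] (m : ℕ) :
    0 ≤ (sizeEGF P).coeff m := by
  rw [coeff_sizeEGF]; split_ifs <;> positivity

theorem factorial_add_mul_factorial_add_le (u d e : ℕ) :
    (u + d)! * (u + e)! ≤ u ! * (u + d + e)! := by
  induction e with
  | zero => simp [mul_comm]
  | succ e ih =>
    rw [← add_assoc, ← add_assoc, Nat.factorial_succ, Nat.factorial_succ]
    calc (u + d)! * ((u + e + 1) * (u + e)!) = (u + e + 1) * ((u + d)! * (u + e)!) := by ring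
      _ ≤ (u + d + e + 1) * (u ! * (u + d + e)!) := Nat.mul_le_mul (by omega) ih
      _ = u ! * ((u + d + e + 1) * (u + d + e)!) := by ring

theorem logConcaveCoeff_sizeEGF (L : ℕ) : LogConcaveCoeff (sizeEGF (L ≤ ·)) := by
  intro u d e
  by_cases hu : L ≤ u
  · simp only [coeff_sizeEGF]
    rw [if_pos hu, if_pos (by omega), if_pos (by omega), if_pos (by omega), ← mul_inv, ← mul_inv]
    refine inv_anti₀ (by positivity) ?_
    exact_mod_cast factorial_add_mul_factorial_add_le u d e
  · rw [coeff_sizeEGF, if_neg hu, zero_mul]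
    exact mul_nonneg (coeff_sizeEGF_nonneg _ _) (coeff_sizeEGF_nonneg _ _)

theorem likelihoodRatioLE_sizeEGF {L M : ℕ} (hLM : L ≤ M) :
    LikelihoodRatioLE (sizeEGF (L ≤ ·)) (sizeEGF (M ≤ ·)) := by
  intro i j hij
  by_cases hi : M ≤ i
  · simp only [coeff_sizeEGF]
    rw [if_pos hi, if_pos (by omega), if_pos (by omega), if_pos (by omega), mul_comm]
  · rw [coeff_sizeEGF (M ≤ ·), if_neg hi, mul_zero]
    exact mul_nonneg (coeff_sizeEGF_nonneg _ _) (coeff_sizeEGF_nonneg _ _)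

theorem coeff_sizeEGF_anti {L M : ℕ} (hLM : L ≤ M) (n : ℕ) :
    (sizeEGF (M ≤ ·)).coeff n ≤ (sizeEGF (L ≤ ·)).coeff n := by
  simp only [coeff_sizeEGF]
  split_ifs
  · rfl
  · omega
  · positivity
  · rfl

theorem coeff_one_add_pow (f : ℝ⟦X⟧) {k N : ℕ} (hk : k < N) (n : ℕ) :
    ((1 + f) ^ k).coeff n = ∑ r ∈ range N, (f ^ r).coeff n * k.choose r := by
  rw [add_comm, add_pow, map_sum]
  rw [← sum_subset (range_subset_range.2 hk)]
  · refine sum_congr rfl fun r _ => ?_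
    rw [one_pow, mul_one, ← Nat.cast_comm, ← nsmul_eq_mul, map_nsmul, nsmul_eq_mul, mul_comm]
  · intro r _ hr
    rw [Nat.choose_eq_zero_of_lt (by simpa using hr)]
    simp

theorem choose_succ_mul_choose_le {p q : ℕ} (k : ℕ) (hpq : p ≤ q) :
    k.choose q * (k + 1).choose p ≤ k.choose p * (k + 1).choose q := by
  rcases lt_or_ge k q with hq | hq
  · simp [Nat.choose_eq_zero_of_lt hq]
  have h1 := Nat.choose_mul_succ_eq k p
  have h2 := Nat.choose_mul_succ_eq k q
  refine Nat.le_of_mul_le_mul_right (c := (k + 1)) ?_ (by omega)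
  calc k.choose q * (k + 1).choose p * (k + 1)
      = (k + 1).choose q * (k + 1).choose p * (k + 1 - q) := by rw [mul_right_comm, h2]; ring
    _ ≤ (k + 1).choose q * (k + 1).choose p * (k + 1 - p) := by gcongr
    _ = k.choose p * (k + 1).choose q * (k + 1) := by rw [mul_right_comm _ _ (k + 1), h1]; ring

theorem coeff_sizeEGF_sq_lt {n : ℕ} (hn : 2 ≤ n) :
    (sizeEGF (2 ≤ ·) ^ 2).coeff n < (sizeEGF (1 ≤ ·) ^ 2).coeff n := by
  rw [sq, sq, PowerSeries.coeff_mul, PowerSeries.coeff_mul]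
  refine sum_lt_sum (fun p _ => mul_le_mul (coeff_sizeEGF_anti one_le_two _)
    (coeff_sizeEGF_anti one_le_two _) (coeff_sizeEGF_nonneg _ _) (coeff_sizeEGF_nonneg _ _))
    ⟨(1, n - 1), by rw [HasAntidiagonal.mem_antidiagonal]; omega, ?_⟩
  simp only [coeff_sizeEGF]
  rw [if_neg (by omega), if_pos le_rfl, if_pos (by omega : 1 ≤ n - 1), zero_mul]
  positivity

theorem one_add_sizeEGF_one_le : 1 + sizeEGF (1 ≤ ·) = sizeEGF fun _ => True := by
  ext n
  rw [map_add, PowerSeries.coeff_one, coeff_sizeEGF, coeff_sizeEGF]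
  rcases n with _ | n <;> simp

theorem one_add_sizeEGF_two_le : 1 + sizeEGF (2 ≤ ·) = sizeEGF (· ≠ 1) := by
  ext n
  rw [map_add, PowerSeries.coeff_one, coeff_sizeEGF, coeff_sizeEGF]
  rcases n with _ | _ | n <;> simp

theorem coeff_sizeEGF_pow_cross_lt {n k : ℕ} (hn : 2 ≤ n) (hk : 1 ≤ k) :
    (sizeEGF (· ≠ 1) ^ (k + 1)).coeff n * (sizeEGF (fun _ => True) ^ k).coeff n <
      (sizeEGF (· ≠ 1) ^ k).coeff n * (sizeEGF (fun _ => True) ^ (k + 1)).coeff n := by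
  rw [← one_add_sizeEGF_one_le, ← one_add_sizeEGF_two_le]
  have hk2 : k + 1 < k + 2 := by omega
  rw [coeff_one_add_pow _ hk2, coeff_one_add_pow _ hk2,
    coeff_one_add_pow _ (k.lt_succ_self.trans hk2), coeff_one_add_pow _ (k.lt_succ_self.trans hk2)]
  refine sum_mul_sum_lt_of_cross (p := 1) (q := 2) (fun p q hpq _ => ?_) (fun p q hpq _ => ?_)
    (by omega) (by omega) ?_ ?_
  · exact (likelihoodRatioLE_sizeEGF one_le_two).coeff_pow_mul_coeff_pow_le
      (logConcaveCoeff_sizeEGF 1) (logConcaveCoeff_sizeEGF 2) (coeff_sizeEGF_nonneg _)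
      (coeff_sizeEGF_anti one_le_two) hpq n
  · exact_mod_cast choose_succ_mul_choose_le k hpq
  · have h : ∀ L ≤ n, (sizeEGF (L ≤ ·) ^ 1).coeff n = (n ! : ℝ)⁻¹ := fun L hL => by
      rw [pow_one, coeff_sizeEGF, if_pos hL]
    rw [h 1 (by omega), h 2 hn, mul_comm]
    exact mul_lt_mul_of_pos_left (coeff_sizeEGF_sq_lt hn) (by positivity)
  · have h1 : k.choose 2 * (k + 1) = (k + 1).choose 2 * (k - 1) := Nat.choose_mul_succ_eq k 2
    have h2 : 0 < (k + 1).choose 2 := Nat.choose_pos (by omega)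
    have : k.choose 2 * (k + 1).choose 1 < k.choose 1 * (k + 1).choose 2 := by
      rw [Nat.choose_one_right, Nat.choose_one_right, h1, mul_comm k]
      exact Nat.mul_lt_mul_of_pos_left (by omega) h2
    exact_mod_cast this

/-- The size of the fiber of `f` over each point. -/
def fiberCard {n k : ℕ} (f : Fin n → Fin k) (i : Fin k) : ℕ := #{p | f p = i}

theorem sum_fiberCard {n k : ℕ} (f : Fin n → Fin k) : ∑ i, fiberCard f i = n := by
  simpa [fiberCard] using (card_eq_sum_card_fiberwise (f := f) (s := univ) (t := univ)
    (by simp)).symm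

theorem card_fiberCard_eq {n k : ℕ} (d : Fin k →₀ ℕ) (hd : ∑ i, d i = n) :
    #{f : Fin n → Fin k | fiberCard f = d} = Nat.multinomial univ d := by
  have h1 := Fintype.sum_pow (fun i => (MvPolynomial.X i : MvPolynomial (Fin k) ℕ)) n
  rw [sum_pow_eq_sum_piAntidiag] at h1
  have h2 := congrArg (MvPolynomial.coeff d) h1
  have hcomp : ∀ f : Fin n → Fin k, ∏ p, (MvPolynomial.X (f p) : MvPolynomial (Fin k) ℕ) =
      ∏ i, MvPolynomial.X i ^ fiberCard f i := fun f => by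
    simpa [fiberCard] using
      (prod_fiberwise' univ f fun i => (MvPolynomial.X i : MvPolynomial (Fin k) ℕ)).symm
  have hcoeff : ∀ e : Fin k → ℕ, MvPolynomial.coeff d
      (∏ i, (MvPolynomial.X i : MvPolynomial (Fin k) ℕ) ^ e i) = if e = d then 1 else 0 :=
    fun e => by
      rw [MvPolynomial.coeff_prod_X_pow]
      congr 1
      simp [DFunLike.ext_iff, funext_iff, eq_comm]
  simp only [MvPolynomial.coeff_sum, hcomp, hcoeff, ← nsmul_eq_mul,
    MvPolynomial.coeff_smul] at h2
  simp only [sum_boole, smul_eq_mul, Nat.cast_id, mul_ite, mul_one, mul_zero] at h2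
  rw [← h2, sum_ite_eq', if_pos (by simpa using hd)]

theorem card_forall_fiberCard (P : ℕ → Prop) [DecidablePred P] (n k : ℕ) :
    (#{f : Fin n → Fin k | ∀ i, P (fiberCard f i)} : ℝ) = n ! * (sizeEGF P ^ k).coeff n := by
  have hpow : sizeEGF P ^ k = ∏ _i : Fin k, sizeEGF P := by simp
  rw [hpow, PowerSeries.coeff_prod, mul_sum,
    card_eq_sum_card_fiberwise (f := fun f => Finsupp.equivFunOnFinite.symm (fiberCard f))
      (t := finsuppAntidiag univ n), Nat.cast_sum]
  · refine sum_congr rfl fun d hd => ?_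
    have hdn : ∑ i, d i = n := by simpa using hd
    simp only [coeff_sizeEGF]
    have hfil : ∀ f : Fin n → Fin k,
        Finsupp.equivFunOnFinite.symm (fiberCard f) = d ↔ fiberCard f = d := fun f => by
      rw [Equiv.symm_apply_eq]; rfl
    simp only [hfil, filter_filter]
    by_cases hP : ∀ i, P (d i)
    · have : ∀ f : Fin n → Fin k,
          ((∀ i, P (fiberCard f i)) ∧ fiberCard f = d) ↔ fiberCard f = d := fun f =>
        and_iff_right_of_imp fun h => h ▸ hP
      simp only [this, hP, if_true]
      rw [card_fiberCard_eq d hdn, prod_inv_distrib, ← hdn, ← Nat.multinomial_spec]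
      push_cast
      field_simp
    · have : ∀ f : Fin n → Fin k, ¬((∀ i, P (fiberCard f i)) ∧ fiberCard f = d) := fun f h =>
        hP (h.2 ▸ h.1)
      push Not at hP
      obtain ⟨i, hi⟩ := hP
      rw [prod_eq_zero (mem_univ i) (if_neg hi)]
      simp [this]
  · intro f _
    simpa using sum_fiberCard f

theorem coeff_sizeEGF_true_pow (n k : ℕ) :
    (n ! : ℝ) * (sizeEGF (fun _ => True) ^ k).coeff n = (k : ℝ) ^ n := by
  rw [← card_forall_fiberCard]
  simp

/-- Exchange the roles of the old bus and the reassignment choice: the new bus of a passenger with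
data `(a, b)` is the first component of the image. -/
def busSwap (k : ℕ) : Fin (k + 1) × Fin k ≃ Fin k × Fin (k + 1) where
  toFun c := Fin.lastCases (c.2, Fin.last k) (fun i => (i, c.2.castSucc)) c.1
  invFun c := Fin.lastCases (Fin.last k, c.1) (fun j => (c.1.castSucc, j)) c.2
  left_inv := by
    rintro ⟨a, b⟩
    induction a using Fin.lastCases <;> simp
  right_inv := by
    rintro ⟨a, b⟩
    induction b using Fin.lastCases <;> simp

theorem busSwap_fst_eq_iff {k : ℕ} (a : Fin (k + 1)) (b i : Fin k) :
    (busSwap k (a, b)).1 = i ↔ a = i.castSucc ∨ a = Fin.last k ∧ b = i := by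
  induction a using Fin.lastCases with
  | last => simp [busSwap, (Fin.castSucc_ne_last i).symm]
  | cast j => simp [busSwap]

theorem exists_perm_lt_card {n : ℕ} (p : Fin n → Prop) [DecidablePred p] :
    ∃ σ : Equiv.Perm (Fin n), ∀ j, p j ↔ (σ j : ℕ) < #{j | p j} := by
  have hle : #{j | p j} ≤ n := (card_filter_le _ _).trans (by simp)
  have hcard : Fintype.card {j // p j} = Fintype.card {j : Fin n // (j : ℕ) < #{j | p j}} := by
    rw [Fintype.card_subtype, Fintype.card_subtype, Fin.card_filter_val_lt, min_eq_right hle]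
  let e := Fintype.equivOfCardEq hcard
  refine ⟨e.extendSubtype, fun j => ⟨fun hj => e.extendSubtype_mem j hj, fun hj => ?_⟩⟩
  by_contra h
  exact e.extendSubtype_not_mem j h hj

/-- A bijection of configurations under which the bus after reassignment becomes a coordinate. -/
theorem exists_equiv_Xcount' (n k : ℕ) :
    ∃ e : Config n k ≃ (Fin n → Fin k) × (Fin n → Fin (k + 1)),
      ∀ c, Xcount' n k c = fiberCard (e c).1 := by
  choose σ hσ using fun x : Fin n → Fin (k + 1) => exists_perm_lt_card fun p => x p = Fin.last k
  refine ⟨(Equiv.prodShear (Equiv.refl _) fun x => (σ x).symm.arrowCongr (Equiv.refl _)).trans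
    ((Equiv.arrowProdEquivProdArrow _ _ _).symm.trans
      (((Equiv.refl _).arrowCongr (busSwap k)).trans (Equiv.arrowProdEquivProdArrow _ _ _))), ?_⟩
  rintro ⟨x, y⟩
  funext i
  have hfiber : ∀ p, (busSwap k (x p, y (σ x p))).1 = i ↔
      x p = i.castSucc ∨ x p = Fin.last k ∧ y (σ x p) = i := fun p => busSwap_fst_eq_iff _ _ _
  change _ = #{p | (busSwap k (x p, y (σ x p))).1 = i}
  simp only [hfiber]
  rw [filter_or, card_union_of_disjoint]
  · rw [Xcount', Xcount]
    congr 1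
    refine (card_equiv (σ x) fun p => ?_).symm
    simp only [mem_filter, mem_univ, true_and, Xcount]
    rw [hσ x p]
  · rw [disjoint_filter]
    rintro p _ h ⟨h', _⟩
    exact Fin.castSucc_ne_last i (h.symm.trans h')

open Classical in
theorem card_compl_eventA (n k : ℕ) :
    (#{c | c ∈ (eventA n k)ᶜ} : ℝ) =
      n ! * (sizeEGF (· ≠ 1) ^ (k + 1)).coeff n * (k : ℝ) ^ n := by
  rw [← card_forall_fiberCard]
  have : ({c | c ∈ (eventA n k)ᶜ} : Finset (Config n k)) =
      ({f : Fin n → Fin (k + 1) | ∀ i, fiberCard f i ≠ 1} : Finset _) ×ˢ univ := by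
    ext c
    rw [mem_product, mem_filter_univ, mem_filter_univ]
    simp [eventA, Xcount, fiberCard]
  rw [this, card_product]
  simp

open Classical in
theorem card_compl_eventA' (n k : ℕ) :
    (#{c | c ∈ (eventA' n k)ᶜ} : ℝ) =
      n ! * (sizeEGF (· ≠ 1) ^ k).coeff n * ((k + 1 : ℕ) : ℝ) ^ n := by
  rw [← card_forall_fiberCard]
  obtain ⟨e, he⟩ := exists_equiv_Xcount' n k
  have : #{c | c ∈ (eventA' n k)ᶜ} =
      #(({f : Fin n → Fin k | ∀ i, fiberCard f i ≠ 1} : Finset _) ×ˢ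
        (univ : Finset (Fin n → Fin (k + 1)))) :=
    card_equiv e fun c => by simp [eventA', he]
  rw [this, card_product]
  simp

open Classical in
theorem card_compl_eventA_lt {n k : ℕ} (hn : 2 ≤ n) (hk : 1 ≤ k) :
    #{c | c ∈ (eventA n k)ᶜ} < #{c | c ∈ (eventA' n k)ᶜ} := by
  have h := mul_lt_mul_of_pos_left (coeff_sizeEGF_pow_cross_lt hn hk)
    (by positivity : (0 : ℝ) < n ! * n !)
  have h1 := coeff_sizeEGF_true_pow n k
  have h2 := coeff_sizeEGF_true_pow n (k + 1)
  rw [← Nat.cast_lt (α := ℝ), card_compl_eventA, card_compl_eventA', ← h1, ← h2]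
  linarith

/-- The strict inequality `P(A ∩ (A')ᶜ) > P(A' ∩ Aᶜ)`. -/
theorem prob_gain_gt_loss (n k : ℕ) (hn : 2 ≤ n) (hk : 1 ≤ k) :
    prob n k (eventA' n k ∩ (eventA n k)ᶜ) <
      prob n k (eventA n k ∩ (eventA' n k)ᶜ) := by
  classical
  have : Nonempty (Fin k) := ⟨⟨0, hk⟩⟩
  have hpos : (0 : ℝ) < Fintype.card (Config n k) := by exact_mod_cast Fintype.card_pos
  refine div_lt_div_of_pos_right (Nat.cast_lt.2 ?_) hpos
  have h := card_compl_eventA_lt hn hk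
  rw [← card_filter_add_card_filter_not (s := {c | c ∈ (eventA n k)ᶜ}) (· ∈ eventA' n k),
    ← card_filter_add_card_filter_not (s := {c | c ∈ (eventA' n k)ᶜ}) (· ∈ eventA n k)] at h
  simp only [filter_filter, Set.mem_compl_iff] at h
  simp only [Set.mem_inter_iff, Set.mem_compl_iff]
  simp only [and_comm] at h ⊢
  omega
end

section
/- The events D'_{m,ℓ} for (m, ℓ) ∈ P_idx are pairwise disjoint, their union contains A'_r ∩ (A_r)ᶜ, and consequently P(A'_r ∩ (A_r)ᶜ) ≤ Σ_{(m,ℓ)∈P_idx} P(D'_{m,ℓ}). -/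
open Finset

/-- The number of buses `i ∈ [k]` with exactly one passenger (before
reassignment). -/
def onesCount (n k : ℕ) (c : Config n k) : ℕ :=
  (Finset.univ.filter fun i : Fin k => Xcount n k c i.castSucc = 1).card

/-- The event `A_r` that at least `r` of the buses `1, …, k + 1` have exactly
one passenger before reassignment. -/
def eventAr (n k r : ℕ) : Set (Config n k) :=
  {c | r ≤ (Finset.univ.filter fun i : Fin (k + 1) => Xcount n k c i = 1).card}

/-- The event `A'_r` that at least `r` of the buses `1, …, k` have exactly one
passenger after reassignment. -/
def eventAr' (n k r : ℕ) : Set (Config n k) :=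
  {c | r ≤ (Finset.univ.filter fun i : Fin k => Xcount' n k c i = 1).card}

/-- The index set `P = {(m, ℓ) : m ≥ 2, ℓ ≥ 0, 0 < r − ℓ ≤ m}`. -/
def Pidx (r : ℕ) : Set (ℕ × ℕ) := {p | 2 ≤ p.1 ∧ p.2 < r ∧ r - p.2 ≤ p.1}

open Classical in
/-- The set of buses `s ∈ [k]` with `X_s = 0` and a unique `j ∈ [m]` with
`Y_j = s`. -/
noncomputable def goodS (n k m : ℕ) (c : Config n k) : Finset (Fin k) :=
  Finset.univ.filter fun s =>
    Xcount n k c s.castSucc = 0 ∧ ∃! j : Fin n, (j : ℕ) < m ∧ c.2 j = s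

/-- The event `D'_{m,ℓ}`: `X_{k+1} = m`; exactly `ℓ` buses `i ∈ [k]` have
`X_i = 1`; at least `r − ℓ` buses `s ∈ [k]` have `X_s = 0` and a unique
`j ∈ [m]` with `Y_j = s`; and if there are exactly `r − ℓ` such `s` then no
`j ∈ [m]` has `X_{Y_j} = 1`. -/
def eventD' (n k r m ℓ : ℕ) : Set (Config n k) :=
  {c | Xcount n k c (Fin.last k) = m ∧
       onesCount n k c = ℓ ∧
       r - ℓ ≤ (goodS n k m c).card ∧
       ((goodS n k m c).card = r - ℓ →
         ∀ j : Fin n, (j : ℕ) < m → Xcount n k c ((c.2 j).castSucc) ≠ 1)}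

lemma prob_empty (n k : ℕ) : prob n k ∅ = 0 := by
  simp [prob]

/-- Union bound for a finite family of events. -/
lemma prob_le_sum {ι : Type*} (n k : ℕ) (F : Finset ι) (D : ι → Set (Config n k))
    (E : Set (Config n k)) (h : ∀ c ∈ E, ∃ i ∈ F, c ∈ D i) :
    prob n k E ≤ ∑ i ∈ F, prob n k (D i) := by
  classical
  unfold prob
  rw [← Finset.sum_div]
  gcongr
  have hsub : (Finset.univ.filter fun c => c ∈ E) ⊆
      F.biUnion fun i => Finset.univ.filter fun c => c ∈ D i := by
    intro c hc
    simpa using h c (by simpa using hc)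
  have hcard := (Finset.card_le_card hsub).trans Finset.card_biUnion_le
  exact_mod_cast hcard

/-- Union bound for a family of events of which only finitely many are nonempty. -/
lemma prob_le_tsum {ι : Type*} (n k : ℕ) (D : ι → Set (Config n k))
    (hD : {i | (D i).Nonempty}.Finite) (E : Set (Config n k)) (h : ∀ c ∈ E, ∃ i, c ∈ D i) :
    prob n k E ≤ ∑' i, prob n k (D i) := by
  rw [tsum_eq_sum (s := hD.toFinset)]
  · refine prob_le_sum n k _ D E fun c hc => ?_
    obtain ⟨i, hi⟩ := h c hc
    exact ⟨i, hD.mem_toFinset.2 ⟨c, hi⟩, hi⟩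
  · intro i hi
    have hempty : D i = ∅ := by
      simpa [Set.not_nonempty_iff_eq_empty] using hi
    rw [hempty, prob_empty]

lemma eq_of_mem_eventD' {n k r m ℓ : ℕ} {c : Config n k} (h : c ∈ eventD' n k r m ℓ) :
    (m, ℓ) = (Xcount n k c (Fin.last k), onesCount n k c) :=
  Prod.ext h.1.symm h.2.1.symm

lemma card_goodS_le (n k m : ℕ) (c : Config n k) : (goodS n k m c).card ≤ m := by
  classical
  have hsub : goodS n k m c ⊆ (Finset.univ.filter fun j : Fin n => (j : ℕ) < m).image c.2 := by
    intro s hs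
    obtain ⟨-, j, ⟨hj, hjs⟩, -⟩ := (Finset.mem_filter.1 hs).2
    exact Finset.mem_image.2 ⟨j, by simpa using hj, hjs⟩
  refine (Finset.card_le_card hsub).trans (Finset.card_image_le.trans ?_)
  rw [Fin.card_filter_val_lt]
  exact min_le_right _ _

/-- The number of singly occupied buses before reassignment, split off the last bus. -/
lemma card_ones_eq (n k : ℕ) (c : Config n k) :
    (Finset.univ.filter fun i : Fin (k + 1) => Xcount n k c i = 1).card =
      onesCount n k c + if Xcount n k c (Fin.last k) = 1 then 1 else 0 := by
  simp only [onesCount, Finset.card_filter, Fin.sum_univ_castSucc]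

open Classical in
/-- The singly occupied buses after reassignment are among the buses in `goodS` and the
initially singly occupied buses that receive no passenger. -/
lemma card_ones'_add_le (n k : ℕ) (c : Config n k) :
    (Finset.univ.filter fun i : Fin k => Xcount' n k c i = 1).card +
        (Finset.univ.filter fun i : Fin k => Xcount n k c i.castSucc = 1 ∧
          ∃ j : Fin n, (j : ℕ) < Xcount n k c (Fin.last k) ∧ c.2 j = i).card ≤
      (goodS n k (Xcount n k c (Fin.last k)) c).card + onesCount n k c := by
  set m := Xcount n k c (Fin.last k) with hm
  have hsplit := Finset.card_filter_add_card_filter_not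
    (s := Finset.univ.filter fun i : Fin k => Xcount n k c i.castSucc = 1)
    (fun i => ∃ j : Fin n, (j : ℕ) < m ∧ c.2 j = i)
  rw [Finset.filter_filter, Finset.filter_filter] at hsplit
  have hsub : (Finset.univ.filter fun i : Fin k => Xcount' n k c i = 1) ⊆
      goodS n k m c ∪ Finset.univ.filter fun i : Fin k => Xcount n k c i.castSucc = 1 ∧
        ¬ ∃ j : Fin n, (j : ℕ) < m ∧ c.2 j = i := by
    intro i hi
    have hi' : Xcount n k c i.castSucc +
        (Finset.univ.filter fun j : Fin n => (j : ℕ) < m ∧ c.2 j = i).card = 1 :=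
      (Finset.mem_filter.1 hi).2
    rcases Nat.add_eq_one_iff.1 hi' with ⟨h0, h1⟩ | ⟨h1, h0⟩
    · refine Finset.mem_union_left _ (Finset.mem_filter.2 ⟨Finset.mem_univ _, h0, ?_⟩)
      obtain ⟨j, hj⟩ := Finset.card_eq_one.1 h1
      simp only [Finset.ext_iff, Finset.mem_filter, Finset.mem_univ, true_and,
        Finset.mem_singleton] at hj
      exact ⟨j, (hj j).2 rfl, fun j' hj' => (hj j').1 hj'⟩
    · refine Finset.mem_union_right _ (Finset.mem_filter.2 ⟨Finset.mem_univ _, h1, ?_⟩)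
      rintro ⟨j, hj⟩
      exact Finset.filter_eq_empty_iff.1 (Finset.card_eq_zero.1 h0) (Finset.mem_univ j) hj
  have hcard := (Finset.card_le_card hsub).trans (Finset.card_union_le _ _)
  unfold onesCount
  omega

lemma exists_mem_eventD' {n k r : ℕ} {c : Config n k}
    (hc : c ∈ eventAr' n k r ∩ (eventAr n k r)ᶜ) :
    ∃ p ∈ Pidx r, c ∈ eventD' n k r p.1 p.2 := by
  classical
  have hA' : r ≤ (Finset.univ.filter fun i : Fin k => Xcount' n k c i = 1).card := hc.1
  have hA : ¬ r ≤ (Finset.univ.filter fun i : Fin (k + 1) => Xcount n k c i = 1).card := hc.2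
  rw [card_ones_eq] at hA
  have hle := card_ones'_add_le n k c
  have hgood := card_goodS_le n k (Xcount n k c (Fin.last k)) c
  refine ⟨(Xcount n k c (Fin.last k), onesCount n k c), ⟨?_, ?_, ?_⟩, rfl, rfl, ?_, ?_⟩
  · dsimp only
    split_ifs at hA <;> omega
  · dsimp only
    omega
  · dsimp only
    omega
  · dsimp only
    omega
  · intro heq j hj hone
    have hpos : 0 < (Finset.univ.filter fun i : Fin k => Xcount n k c i.castSucc = 1 ∧
        ∃ j : Fin n, (j : ℕ) < Xcount n k c (Fin.last k) ∧ c.2 j = i).card :=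
      Finset.card_pos.2 ⟨c.2 j, Finset.mem_filter.2 ⟨Finset.mem_univ _, hone, j, hj, rfl⟩⟩
    dsimp only at heq
    omega

/-- The events `D'_{m,ℓ}` for `(m, ℓ) ∈ P` are pairwise disjoint, their union
contains `A'_r ∩ (A_r)ᶜ`, and consequently
`P(A'_r ∩ (A_r)ᶜ) ≤ ∑_{(m,ℓ) ∈ P} P(D'_{m,ℓ})`. -/
theorem eventD'_disjoint_cover (n k r : ℕ) (hn : 2 ≤ n) (hk : 1 ≤ k)
    (hr2 : 2 ≤ r) (hrn : r ≤ n) :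
    (∀ p ∈ Pidx r, ∀ q ∈ Pidx r, p ≠ q →
        Disjoint (eventD' n k r p.1 p.2) (eventD' n k r q.1 q.2)) ∧
      (eventAr' n k r ∩ (eventAr n k r)ᶜ ⊆ ⋃ p ∈ Pidx r, eventD' n k r p.1 p.2) ∧
      prob n k (eventAr' n k r ∩ (eventAr n k r)ᶜ) ≤
        ∑' p : Pidx r, prob n k (eventD' n k r (p : ℕ × ℕ).1 (p : ℕ × ℕ).2) := by
  refine ⟨fun p _ q _ hpq => Set.disjoint_left.2 fun c hp hq =>
    hpq ((eq_of_mem_eventD' hp).trans (eq_of_mem_eventD' hq).symm), fun c hc => ?_, ?_⟩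
  · simpa only [Set.mem_iUnion, exists_prop] using exists_mem_eventD' hc
  · refine prob_le_tsum n k
      (fun p : Pidx r => eventD' n k r (p : ℕ × ℕ).1 (p : ℕ × ℕ).2) ?_ _ fun c hc => ?_
    · refine ((Set.finite_range fun c : Config n k =>
        (Xcount n k c (Fin.last k), onesCount n k c)).preimage
          Subtype.val_injective.injOn).subset ?_
      rintro p ⟨c, hc⟩
      exact ⟨c, (eq_of_mem_eventD' hc).symm⟩
    · obtain ⟨p, hp, hcp⟩ := exists_mem_eventD' hc
      exact ⟨⟨p, hp⟩, hcp⟩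
end

section
/- The event D is contained in A_r ∩ (A'_r)ᶜ. -/
open Finset

open Classical in
/-- `J(σ)`, the least (1-based) index `j ∈ [n]` with `X_{Y_j} ≠ 1` if one
exists, and `0` otherwise. -/
noncomputable def Jfun (n k : ℕ) (c : Config n k) : ℕ :=
  if h : ∃ j : ℕ, ∃ hj : j < n, Xcount n k c ((c.2 ⟨j, hj⟩).castSucc) ≠ 1 then
    Nat.find h + 1
  else 0

/-- `X_{Y_J}`, the number of passengers on bus `Y_J` (where `J` is 1-based). -/
noncomputable def XYJ (n k : ℕ) (c : Config n k) : ℕ :=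
  if h : Jfun n k c - 1 < n then
    Xcount n k c ((c.2 ⟨Jfun n k c - 1, h⟩).castSucc)
  else 0

/-- The event `D`: `X_{k+1} = 1`; the number of `i ∈ [k]` with `X_i = 1` is
`r − 1` or `r`; `J > 1`; and `Y_j ≠ Y_{j'}` whenever `j, j' < J` are distinct
(1-based indices). -/
def eventD (n k r : ℕ) : Set (Config n k) :=
  {c | Xcount n k c (Fin.last k) = 1 ∧
       (onesCount n k c = r - 1 ∨ onesCount n k c = r) ∧
       1 < Jfun n k c ∧
       ∀ j j' : Fin n, (j : ℕ) + 1 < Jfun n k c → (j' : ℕ) + 1 < Jfun n k c →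
         j ≠ j' → c.2 j ≠ c.2 j'}

/-- The event `D_{m,ℓ}`: `D` occurs and either the number of `i ∈ [k]` with
`X_i = 1` is `r − 1`, `J + X_{Y_J} = m` and `r − J = ℓ`, or that number is
`r`, `J = m` and `r − J + 1 = ℓ`. -/
def eventDml (n k r m ℓ : ℕ) : Set (Config n k) :=
  eventD n k r ∩
    {c | (onesCount n k c = r - 1 ∧ Jfun n k c + XYJ n k c = m ∧ ℓ + Jfun n k c = r) ∨
         (onesCount n k c = r ∧ Jfun n k c = m ∧ ℓ + Jfun n k c = r + 1)}

/-- If exactly one passenger is on bus `k + 1`, then bus `i` gains one passenger if `i = Y_1` and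
none otherwise. -/
theorem Xcount'_eq_of_last_eq_one {n k : ℕ} {c : Config n k} (hn : 0 < n)
    (h : Xcount n k c (Fin.last k) = 1) (i : Fin k) :
    Xcount' n k c i = Xcount n k c i.castSucc + if c.2 ⟨0, hn⟩ = i then 1 else 0 := by
  have hj (j : Fin n) : ((j : ℕ) < 1 ∧ c.2 j = i) ↔ (j = ⟨0, hn⟩ ∧ c.2 ⟨0, hn⟩ = i) := by
    have hj0 : (j : ℕ) < 1 ↔ j = ⟨0, hn⟩ := by rw [Nat.lt_one_iff, Fin.ext_iff]
    rw [hj0]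
    exact and_congr_right fun hj0 => by rw [hj0]
  simp only [Xcount', h, hj]
  split_ifs with h0 <;> simp [Finset.filter_eq', h0]

/-- If `J > 1`, then bus `Y_1` has exactly one passenger. -/
theorem Xcount_eq_one_of_one_lt_Jfun {n k : ℕ} {c : Config n k} (hn : 0 < n)
    (h : 1 < Jfun n k c) : Xcount n k c (c.2 ⟨0, hn⟩).castSucc = 1 := by
  classical
  unfold Jfun at h
  split_ifs at h with hex
  · by_contra h1
    have := Nat.find_min' hex ⟨hn, h1⟩
    omega
  · omega

/-- If exactly one passenger is on bus `k + 1`, then one more of all `k + 1` buses than of the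
first `k` buses has exactly one passenger. -/
theorem card_filter_Xcount_eq_one {n k : ℕ} {c : Config n k}
    (h : Xcount n k c (Fin.last k) = 1) :
    (Finset.univ.filter fun i : Fin (k + 1) => Xcount n k c i = 1).card =
      onesCount n k c + 1 := by
  rw [onesCount, Finset.card_filter, Fin.sum_univ_castSucc, Finset.card_filter]
  simp [h]

/-- If exactly one passenger is on bus `k + 1` and `J > 1`, then the reassignment lowers the number
of buses among the first `k` with exactly one passenger. -/
theorem card_filter_Xcount'_lt_onesCount {n k : ℕ} {c : Config n k} (hn : 0 < n)
    (h : Xcount n k c (Fin.last k) = 1) (hJ : 1 < Jfun n k c) :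
    (Finset.univ.filter fun i : Fin k => Xcount' n k c i = 1).card < onesCount n k c := by
  have h0 := Xcount_eq_one_of_one_lt_Jfun hn hJ
  refine Finset.card_lt_card <| (Finset.ssubset_iff_of_subset fun i hi => ?_).2
    ⟨c.2 ⟨0, hn⟩, by simpa using h0, by simp [Xcount'_eq_of_last_eq_one hn h, h0]⟩
  simp only [Finset.mem_filter, Finset.mem_univ, true_and,
    Xcount'_eq_of_last_eq_one hn h] at hi ⊢
  split_ifs at hi with hi0
  · exact hi0 ▸ h0
  · exact hi

/-- The event `D` is contained in `A_r ∩ (A'_r)ᶜ`. -/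
theorem eventD_subset (n k r : ℕ) (hn : 2 ≤ n) (hk : 1 ≤ k)
    (hr2 : 2 ≤ r) (hrn : r ≤ n) :
    eventD n k r ⊆ eventAr n k r ∩ (eventAr' n k r)ᶜ := by
  rintro c ⟨hlast, hones, hJ, -⟩
  have hA := card_filter_Xcount_eq_one hlast
  have hA' := card_filter_Xcount'_lt_onesCount (by omega) hlast hJ
  refine ⟨?_, ?_⟩
  · simp only [eventAr, Set.mem_ofPred_eq]
    omega
  · simp only [eventAr', Set.mem_compl_iff, Set.mem_ofPred_eq]
    omega
end
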